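/- Let M = N ⊗̄ P be a tensor product of von Neumann algebras, φ_P ∈ P_* a faithful normal state, and E = id_N ⊗ φ_P : M → N the associated conditional expectation. Then for all nonzero ψ₁, ψ₂ ∈ (N_*)⁺: if ψ₁ is not intertwined with ψ₂ in N (ψ₁ ≁_N ψ₂), then ψ₁ ∘ E = ψ₁ ⊗ φ_P is not intertwined with ψ₂ ∘ E = ψ₂ ⊗ φ_P in M. -/

import Mathlib

/-!
Common framework for formalizing Houdayer–Isono,
"Pointwise inner automorphisms of almost periodic factors".

Von Neumann algebras are modeled concretely, following Mathlib, as
`VonNeumannAlgebra H` for a complex Hilbert space `H`.  Notions that are not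
available in Mathlib (normal states and weights, modular automorphism groups,
Connes cocycles, tensor/free product decompositions, …) are modeled by
explicit predicates/structures whose fields record their standard
characterizing properties (e.g. the modular group of a state is characterized
as the pointwise SOT-continuous one-parameter automorphism group satisfying
the KMS condition).
-/

open scoped ComplexOrder ENNReal

namespace HSC

variable {H : Type} [NormedAddCommGroup H] [InnerProductSpace ℂ H] [CompleteSpace H]

/-- The bounded operators on the Hilbert space `H`. -/
abbrev Op (H : Type) [NormedAddCommGroup H] [InnerProductSpace ℂ H] [CompleteSpace H] : Type :=
  H →L[ℂ] H

/-- Positivity of a bounded operator on a Hilbert space. -/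
def IsPos (x : Op H) : Prop := ContinuousLinearMap.IsPositive x

/-- `p` is an (orthogonal) projection belonging to the set `A` of operators. -/
def IsProjIn (A : Set (Op H)) (p : Op H) : Prop := p ∈ A ∧ star p = p ∧ p * p = p

/-- `u` is a unitary belonging to the set `A` of operators. -/
def IsUnitaryIn (A : Set (Op H)) (u : Op H) : Prop := u ∈ A ∧ star u * u = 1 ∧ u * star u = 1

/-- `v` is a partial isometry. -/
def IsPartialIsom (v : Op H) : Prop := star v * v * (star v * v) = star v * v

/-- `φ` is a positive linear functional on `M` (recorded as a function on all of `B(H)`;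
only its values on `M` matter). -/
structure IsPLF (M : VonNeumannAlgebra H) (φ : Op H → ℂ) : Prop where
  map_add : ∀ x ∈ M, ∀ y ∈ M, φ (x + y) = φ x + φ y
  map_smul : ∀ (c : ℂ), ∀ x ∈ M, φ (c • x) = c * φ x
  pos : ∀ x ∈ M, 0 ≤ φ (star x * x)

/-- `φ` is a *normal* positive linear functional on `M`: a positive linear functional which is
completely additive on orthogonal families of projections (sums taken in the strong topology). -/
structure IsNormalPLF (M : VonNeumannAlgebra H) (φ : Op H → ℂ) extends IsPLF M φ : Prop where
  normal : ∀ (ι : Type) (p : ι → Op H) (q : Op H),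
    (∀ i, IsProjIn (M : Set (Op H)) (p i)) → IsProjIn (M : Set (Op H)) q →
    (Pairwise fun i j => p i * p j = 0) →
    (∀ ξ : H, HasSum (fun i => p i ξ) (q ξ)) →
    HasSum (fun i => φ (p i)) (φ q)

/-- `φ` is a normal state on `M`. -/
def IsNormalState (M : VonNeumannAlgebra H) (φ : Op H → ℂ) : Prop :=
  IsNormalPLF M φ ∧ φ 1 = 1

/-- Faithfulness of a positive linear functional on `M`. -/
def IsFaithfulOn (M : VonNeumannAlgebra H) (φ : Op H → ℂ) : Prop :=
  ∀ x ∈ M, φ (star x * x) = 0 → x = 0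

/-- `φ` is a faithful normal state on `M`. -/
def IsFNState (M : VonNeumannAlgebra H) (φ : Op H → ℂ) : Prop :=
  IsNormalState M φ ∧ IsFaithfulOn M φ

/-- `p` is the support projection `s(φ)` of `φ` in `M`: the smallest projection of `M`
compressing to which does not change `φ`. -/
def IsSupportProjOf (M : VonNeumannAlgebra H) (φ : Op H → ℂ) (p : Op H) : Prop :=
  IsProjIn (M : Set (Op H)) p ∧ (∀ x ∈ M, φ (p * x * p) = φ x) ∧
    ∀ q, IsProjIn (M : Set (Op H)) q → (∀ x ∈ M, φ (q * x * q) = φ x) → p * q = p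

/-- `ψ ∼_M φ` : the normal positive functionals `ψ` and `φ` are intertwined in `M`,
i.e. there are a nonzero partial isometry `v ∈ s(ψ) M s(φ)` and `l > 0` with `ψ v = l v φ`
(with the bimodule conventions `(ψ v)(x) = ψ(vx)`, `(v φ)(x) = φ(xv)`). -/
def Intertwined (M : VonNeumannAlgebra H) (ψ φ : Op H → ℂ) : Prop :=
  ∃ (v q p : Op H) (l : ℝ), 0 < l ∧ v ∈ M ∧ IsPartialIsom v ∧ v ≠ 0 ∧
    IsSupportProjOf M ψ q ∧ IsSupportProjOf M φ p ∧ q * v = v ∧ v * p = v ∧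
    ∀ x ∈ M, ψ (v * x) = (l : ℂ) * φ (x * v)

/-- An automorphism of the von Neumann algebra `M` (automatically normal). -/
structure VNAut (M : VonNeumannAlgebra H) where
  toFun : Op H → Op H
  invFun : Op H → Op H
  mem' : ∀ x ∈ M, toFun x ∈ M
  inv_mem' : ∀ x ∈ M, invFun x ∈ M
  left_inv' : ∀ x ∈ M, invFun (toFun x) = x
  right_inv' : ∀ x ∈ M, toFun (invFun x) = x
  map_add' : ∀ x ∈ M, ∀ y ∈ M, toFun (x + y) = toFun x + toFun y
  map_smul' : ∀ (c : ℂ), ∀ x ∈ M, toFun (c • x) = c • toFun x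
  map_mul' : ∀ x ∈ M, ∀ y ∈ M, toFun (x * y) = toFun x * toFun y
  map_star' : ∀ x ∈ M, toFun (star x) = star (toFun x)

/-- `Θ` is pointwise inner: for every normal state `ψ` there is a unitary `u ∈ M` with
`Θ(ψ) = u ψ u*`, i.e. `ψ(Θ⁻¹(x)) = ψ(u* x u)` for all `x ∈ M`. -/
def PointwiseInner {M : VonNeumannAlgebra H} (Θ : VNAut M) : Prop :=
  ∀ ψ : Op H → ℂ, IsNormalState M ψ →
    ∃ u, IsUnitaryIn (M : Set (Op H)) u ∧
      ∀ x ∈ M, ψ (Θ.invFun x) = ψ (star u * x * u)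

/-- The closed horizontal strip `0 ≤ Im z ≤ 1`. -/
def strip : Set ℂ := {z | 0 ≤ z.im ∧ z.im ≤ 1}

/-- The open horizontal strip `0 < Im z < 1`. -/
def stripo : Set ℂ := {z | 0 < z.im ∧ z.im < 1}

/-- `σ` is the modular automorphism group `σ^φ` of the (faithful normal) state `φ` on `M`:
a pointwise SOT-continuous one-parameter group of ∗-automorphisms of `M` preserving `φ` and
satisfying the KMS condition at inverse temperature 1. -/
structure IsModularFlow (M : VonNeumannAlgebra H) (φ : Op H → ℂ) (σ : ℝ → Op H → Op H) :
    Prop where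
  mem' : ∀ (t : ℝ), ∀ x ∈ M, σ t x ∈ M
  zero' : ∀ x ∈ M, σ 0 x = x
  add' : ∀ (s t : ℝ), ∀ x ∈ M, σ (s + t) x = σ s (σ t x)
  map_add' : ∀ (t : ℝ), ∀ x ∈ M, ∀ y ∈ M, σ t (x + y) = σ t x + σ t y
  map_smul' : ∀ (t : ℝ) (c : ℂ), ∀ x ∈ M, σ t (c • x) = c • σ t x
  map_mul' : ∀ (t : ℝ), ∀ x ∈ M, ∀ y ∈ M, σ t (x * y) = σ t x * σ t y
  map_star' : ∀ (t : ℝ), ∀ x ∈ M, σ t (star x) = star (σ t x)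
  invariant' : ∀ (t : ℝ), ∀ x ∈ M, φ (σ t x) = φ x
  continuous' : ∀ x ∈ M, ∀ ξ : H, Continuous fun t : ℝ => σ t x ξ
  kms' : ∀ x ∈ M, ∀ y ∈ M, ∃ F : ℂ → ℂ, ContinuousOn F strip ∧
    DifferentiableOn ℂ F stripo ∧ (∃ C : ℝ, ∀ z ∈ strip, ‖F z‖ ≤ C) ∧
    (∀ t : ℝ, F (t : ℂ) = φ (σ t x * y)) ∧
    (∀ t : ℝ, F ((t : ℂ) + Complex.I) = φ (y * σ t x))

/-- `l ^ (i t)` for `l > 0`. -/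
noncomputable def cpowit (l t : ℝ) : ℂ := Complex.exp (Complex.I * t * Real.log l)

/-- `x ∈ M` is an `l`-eigenvector of the modular flow `σ`, i.e. `σ_t(x) = l^{it} x`. -/
def IsEigenvector (M : VonNeumannAlgebra H) (σ : ℝ → Op H → Op H) (l : ℝ) (x : Op H) :
    Prop :=
  x ∈ M ∧ ∀ t : ℝ, σ t x = cpowit l t • x

/-- The point spectrum `σ_p(Δ_φ)` of the modular operator, described via eigenvectors in `M`. -/
def pointSpectrum (M : VonNeumannAlgebra H) (σ : ℝ → Op H → Op H) : Set ℝ :=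
  {l | 0 < l ∧ ∃ x, x ≠ 0 ∧ IsEigenvector M σ l x}

/-- The linear span of the eigenvectors of the modular flow. -/
def eigenSpan (M : VonNeumannAlgebra H) (σ : ℝ → Op H → Op H) : Submodule ℂ (Op H) :=
  Submodule.span ℂ {x | ∃ l : ℝ, 0 < l ∧ IsEigenvector M σ l x}

/-- Almost periodicity of `φ` (via its modular flow `σ`): the linear span of the
eigenvectors is ∗-strongly dense in `M`. -/
def IsAlmostPeriodicFlow (M : VonNeumannAlgebra H) (σ : ℝ → Op H → Op H) : Prop :=
  ∀ x ∈ M, ∀ ε : ℝ, 0 < ε → ∀ Ξ : Finset H, ∃ y ∈ eigenSpan M σ,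
    ∀ ξ ∈ Ξ, ‖(x - y) ξ‖ < ε ∧ ‖(star x - star y) ξ‖ < ε

/-- The centralizer `M_φ` of a state `φ` on `M`. -/
def stateCentralizer (M : VonNeumannAlgebra H) (φ : Op H → ℂ) : Set (Op H) :=
  {x | x ∈ M ∧ ∀ y ∈ M, φ (x * y) = φ (y * x)}

/-- The fixed-point algebra of the flow `σ` on `M` (`= M_φ` for the modular flow of a weight). -/
def flowFixed (M : VonNeumannAlgebra H) (σ : ℝ → Op H → Op H) : Set (Op H) :=
  {x | x ∈ M ∧ ∀ t : ℝ, σ t x = x}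

/-- A set of operators (e.g. a von Neumann subalgebra) has trivial center. -/
def IsFactorSet (A : Set (Op H)) : Prop :=
  ∀ x ∈ A, (∀ y ∈ A, x * y = y * x) → ∃ c : ℂ, x = c • (1 : Op H)

/-- `M` is a factor. -/
def IsFactor (M : VonNeumannAlgebra H) : Prop := IsFactorSet (M : Set (Op H))

/-- Murray–von Neumann equivalence of projections, relative to the set `A`. -/
def MvNEquivIn (A : Set (Op H)) (p q : Op H) : Prop :=
  ∃ v ∈ A, star v * v = p ∧ v * star v = q

/-- `p` is a finite projection relative to `A`: no proper subprojection of `p`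
is Murray–von Neumann equivalent (in `A`) to `p`. -/
def IsFiniteProjIn (A : Set (Op H)) (p : Op H) : Prop :=
  ∀ q, IsProjIn A q → q * p = q → MvNEquivIn A p q → q = p

/-- `p` is a minimal projection relative to `A`. -/
def IsMinimalProjIn (A : Set (Op H)) (p : Op H) : Prop :=
  IsProjIn A p ∧ p ≠ 0 ∧ ∀ q, IsProjIn A q → q * p = q → q = 0 ∨ q = p

/-- `M` is a type III factor: a factor with no nonzero finite projection. -/
def IsTypeIIIFactor (M : VonNeumannAlgebra H) : Prop :=
  IsFactor M ∧
    ∀ p, IsProjIn (M : Set (Op H)) p → p ≠ 0 → ¬ IsFiniteProjIn (M : Set (Op H)) p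

/-- The ∗-closed set `A` (e.g. a corner or a subalgebra) is a type II₁ factor:
trivial center, `1` finite, and no minimal projections. -/
def IsTypeII1FactorSet (A : Set (Op H)) : Prop :=
  IsFactorSet A ∧ (1 : Op H) ∈ A ∧ IsFiniteProjIn A 1 ∧ ∀ p, ¬ IsMinimalProjIn A p

/-- `A` is a type I_∞ factor (model for `B(ℓ²)`): a factor with a minimal projection
whose unit is not finite. -/
def IsTypeIInfFactorSet (A : Set (Op H)) : Prop :=
  IsFactorSet A ∧ (1 : Op H) ∈ A ∧ (∃ p, IsMinimalProjIn A p) ∧ ¬ IsFiniteProjIn A 1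

/-- `M` is a type III₁ factor.  By the Connes–Størmer transitivity theorem, among
type III factors with separable predual, type III₁ is characterized by the topological
transitivity of the unitary group action on faithful normal states. -/
def IsTypeIII1Factor (M : VonNeumannAlgebra H) : Prop :=
  IsTypeIIIFactor M ∧
    ∀ φ ψ : Op H → ℂ, IsFNState M φ → IsFNState M ψ → ∀ ε : ℝ, 0 < ε →
      ∃ u, IsUnitaryIn (M : Set (Op H)) u ∧
        ∀ x ∈ M, ‖x‖ ≤ 1 → ‖φ (star u * x * u) - ψ x‖ < ε

/-- `M` is injective (= amenable, = hyperfinite by Connes' theorem):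
there is a norm-one projection `B(H) → M`. -/
def IsInjectiveVNA (M : VonNeumannAlgebra H) : Prop :=
  ∃ E : Op H →ₗ[ℂ] Op H, (∀ x, E x ∈ M) ∧ (∀ x ∈ M, E x = x) ∧ ∀ x, ‖E x‖ ≤ ‖x‖

/-- `M` is (a copy of) the Araki–Woods factor `R_∞`: the unique amenable (injective)
type III₁ factor with separable predual. -/
def IsArakiWoodsRInfty (M : VonNeumannAlgebra H) : Prop :=
  IsTypeIII1Factor M ∧ IsInjectiveVNA M

/-- Data of a faithful normal semifinite weight: its value `val` on positive elements
(in `[0,∞]`), together with a linear extension `cval` of its restriction to the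
definition ideal `m_φ` (the values of `cval` outside `m_φ` are irrelevant). -/
structure WeightData (H : Type) [NormedAddCommGroup H] [InnerProductSpace ℂ H]
    [CompleteSpace H] where
  val : Op H → ℝ≥0∞
  cval : Op H → ℂ

/-- `W` is a faithful normal semifinite weight on `M`. -/
structure IsFNSWeight (M : VonNeumannAlgebra H) (W : WeightData H) : Prop where
  map_add : ∀ x ∈ M, ∀ y ∈ M, IsPos x → IsPos y → W.val (x + y) = W.val x + W.val y
  map_smul : ∀ c : ℝ, 0 < c → ∀ x ∈ M, IsPos x →
    W.val ((c : ℂ) • x) = ENNReal.ofReal c * W.val x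
  faithful : ∀ x ∈ M, IsPos x → W.val x = 0 → x = 0
  semifinite : ∀ x ∈ M, IsPos x → x ≠ 0 →
    ∃ y ∈ M, IsPos y ∧ y ≠ 0 ∧ IsPos (x - y) ∧ W.val y ≠ ⊤
  normal : ∀ (ι : Type) (p : ι → Op H) (q : Op H),
    (∀ i, IsProjIn (M : Set (Op H)) (p i)) → IsProjIn (M : Set (Op H)) q →
    (Pairwise fun i j => p i * p j = 0) →
    (∀ ξ : H, HasSum (fun i => p i ξ) (q ξ)) →
    W.val q = ∑' i, W.val (p i)
  cval_add : ∀ x ∈ M, ∀ y ∈ M, W.cval (x + y) = W.cval x + W.cval y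
  cval_smul : ∀ (c : ℂ), ∀ x ∈ M, W.cval (c • x) = c * W.cval x
  cval_compat : ∀ x ∈ M, IsPos x → W.val x ≠ ⊤ → W.cval x = ((W.val x).toReal : ℂ)

/-- `σ` is the modular automorphism group `σ^φ` of the faithful normal semifinite
weight `W` on `M` (KMS condition required on the definition ideal). -/
structure IsModularFlowW (M : VonNeumannAlgebra H) (W : WeightData H)
    (σ : ℝ → Op H → Op H) : Prop where
  mem' : ∀ (t : ℝ), ∀ x ∈ M, σ t x ∈ M
  zero' : ∀ x ∈ M, σ 0 x = x
  add' : ∀ (s t : ℝ), ∀ x ∈ M, σ (s + t) x = σ s (σ t x)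
  map_add' : ∀ (t : ℝ), ∀ x ∈ M, ∀ y ∈ M, σ t (x + y) = σ t x + σ t y
  map_smul' : ∀ (t : ℝ) (c : ℂ), ∀ x ∈ M, σ t (c • x) = c • σ t x
  map_mul' : ∀ (t : ℝ), ∀ x ∈ M, ∀ y ∈ M, σ t (x * y) = σ t x * σ t y
  map_star' : ∀ (t : ℝ), ∀ x ∈ M, σ t (star x) = star (σ t x)
  invariant' : ∀ (t : ℝ), ∀ x ∈ M, IsPos x → W.val (σ t x) = W.val x
  continuous' : ∀ x ∈ M, ∀ ξ : H, Continuous fun t : ℝ => σ t x ξ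
  kms' : ∀ x ∈ M, ∀ y ∈ M,
    W.val (star x * x) ≠ ⊤ → W.val (x * star x) ≠ ⊤ →
    W.val (star y * y) ≠ ⊤ → W.val (y * star y) ≠ ⊤ →
    ∃ F : ℂ → ℂ, ContinuousOn F strip ∧ DifferentiableOn ℂ F stripo ∧
      (∃ C : ℝ, ∀ z ∈ strip, ‖F z‖ ≤ C) ∧
      (∀ t : ℝ, F (t : ℂ) = W.cval (σ t x * y)) ∧
      (∀ t : ℝ, F ((t : ℂ) + Complex.I) = W.cval (y * σ t x))

/-- The weight `W` is strictly semifinite: its restriction to the centralizer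
(= fixed points of the modular flow `σ`) is semifinite. -/
def IsStrictlySemifiniteOn (M : VonNeumannAlgebra H) (W : WeightData H)
    (σ : ℝ → Op H → Op H) : Prop :=
  ∀ x ∈ flowFixed M σ, IsPos x → x ≠ 0 →
    ∃ y ∈ flowFixed M σ, IsPos y ∧ y ≠ 0 ∧ IsPos (x - y) ∧ W.val y ≠ ⊤

/-- `h` is a positive element of the corner `pAp`, invertible in this corner. -/
def CornerPosInvertibleIn (A : Set (Op H)) (p h : Op H) : Prop :=
  h ∈ A ∧ IsPos h ∧ p * h = h ∧ h * p = h ∧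
    ∃ h' ∈ A, p * h' = h' ∧ h' * p = h' ∧ h * h' = p ∧ h' * h = p

/-- `Θ` is locally pointwise inner for the strictly semifinite weight `W` (with modular flow
`σ`): `Θ(φ) = φ`, and for every nonzero projection `p ∈ M_φ` with `φ(p) < ∞` and every
positive invertible `h ∈ pM_φp` one has `Θ(φ_h) ∼_M φ_h`, where `φ_h = φ(h^{1/2}·h^{1/2})`
(below `k = h^{1/2}` is the positive square root of `h` in `M_φ`). -/
def LocallyPointwiseInnerW {M : VonNeumannAlgebra H} (W : WeightData H)
    (σ : ℝ → Op H → Op H) (Θ : VNAut M) : Prop :=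
  (∀ x ∈ M, IsPos x → W.val (Θ.invFun x) = W.val x) ∧
  ∀ p, IsProjIn (flowFixed M σ) p → p ≠ 0 → W.val p ≠ ⊤ →
  ∀ h, CornerPosInvertibleIn (flowFixed M σ) p h →
  ∀ k, k ∈ flowFixed M σ → IsPos k → k * k = h →
    Intertwined M (fun x => W.cval (k * Θ.invFun x * k)) (fun x => W.cval (k * x * k))

/-- `Θ` is locally pointwise inner for the faithful normal state `φ` with modular flow `σ`. -/
def LocallyPointwiseInnerS {M : VonNeumannAlgebra H} (φ : Op H → ℂ)
    (σ : ℝ → Op H → Op H) (Θ : VNAut M) : Prop :=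
  (∀ x ∈ M, φ (Θ.invFun x) = φ x) ∧
  ∀ p, IsProjIn (flowFixed M σ) p → p ≠ 0 →
  ∀ h, CornerPosInvertibleIn (flowFixed M σ) p h →
  ∀ k, k ∈ flowFixed M σ → IsPos k → k * k = h →
    Intertwined M (fun x => φ (k * Θ.invFun x * k)) (fun x => φ (k * x * k))

/-- `Θ` is locally pointwise inner for the faithful normal state `φ`, stated with the
algebraically-defined centralizer `M_φ = {x : φ(xy) = φ(yx)}`. -/
def LocallyPointwiseInnerC {M : VonNeumannAlgebra H} (φ : Op H → ℂ) (Θ : VNAut M) : Prop :=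
  (∀ x ∈ M, φ (Θ.invFun x) = φ x) ∧
  ∀ p, IsProjIn (stateCentralizer M φ) p → p ≠ 0 →
  ∀ h, CornerPosInvertibleIn (stateCentralizer M φ) p h →
  ∀ k, k ∈ stateCentralizer M φ → IsPos k → k * k = h →
    Intertwined M (fun x => φ (k * Θ.invFun x * k)) (fun x => φ (k * x * k))

/-- `E : M → N` is a faithful normal conditional expectation. -/
structure IsCondExp (M N : VonNeumannAlgebra H) (E : Op H → Op H) : Prop where
  subset' : (N : Set (Op H)) ⊆ (M : Set (Op H))
  mem' : ∀ x ∈ M, E x ∈ N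
  fix' : ∀ x ∈ N, E x = x
  map_add' : ∀ x ∈ M, ∀ y ∈ M, E (x + y) = E x + E y
  map_smul' : ∀ (c : ℂ), ∀ x ∈ M, E (c • x) = c • E x
  bimod' : ∀ a ∈ N, ∀ x ∈ M, ∀ b ∈ N, E (a * x * b) = a * E x * b
  map_star' : ∀ x ∈ M, E (star x) = star (E x)
  pos' : ∀ x ∈ M, IsPos x → IsPos (E x)
  faithful' : ∀ x ∈ M, IsPos x → E x = 0 → x = 0
  normal' : ∀ ρ : Op H → ℂ, IsNormalState N ρ → IsNormalState M (fun x => ρ (E x))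

/-- The triple `(M, N, φ)` (with expectation `E : M → N`, `φ ∘ E = φ`) is
intertwining stable (Definition 4.1 of Houdayer–Isono). -/
def IntertwiningStable (M N : VonNeumannAlgebra H) (E : Op H → Op H)
    (φ : Op H → ℂ) : Prop :=
  ∀ Θ : VNAut M,
    (∀ x ∈ M, E (Θ.toFun x) = Θ.toFun (E x)) →
    (∀ x ∈ M, φ (Θ.invFun x) = φ x) →
    ∀ ψ : Op H → ℂ, IsNormalPLF N ψ → (∃ x ∈ N, ψ x ≠ 0) →
      Intertwined M (fun x => ψ (E (Θ.invFun x))) (fun x => ψ (E x)) →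
      Intertwined N (fun x => ψ (Θ.invFun x)) ψ

/-- `M = N ⊗̄ P`: `N` and `P` are commuting subalgebras of `M` which generate `M`
and admit normal product states (slice maps). -/
structure IsTensorDecomposition (M N P : VonNeumannAlgebra H) : Prop where
  subN : (N : Set (Op H)) ⊆ (M : Set (Op H))
  subP : (P : Set (Op H)) ⊆ (M : Set (Op H))
  comm : ∀ x ∈ N, ∀ y ∈ P, x * y = y * x
  generates :
    Set.centralizer (Set.centralizer ((N : Set (Op H)) ∪ (P : Set (Op H)))) = (M : Set (Op H))
  slice : ∀ (ρN ρP : Op H → ℂ), IsNormalState N ρN → IsNormalState P ρP →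
    ∃ ρ : Op H → ℂ, IsNormalState M ρ ∧ ∀ x ∈ N, ∀ y ∈ P, ρ (x * y) = ρN x * ρP y

/-- `E = id_N ⊗ φ_P : N ⊗̄ P → N` is the slice conditional expectation attached to `φ_P`. -/
def IsSliceExpectation (M N P : VonNeumannAlgebra H) (φP : Op H → ℂ)
    (E : Op H → Op H) : Prop :=
  IsCondExp M N E ∧ ∀ x ∈ N, ∀ y ∈ P, E (x * y) = φP y • x

/-- `(M, φ) = (N, φN) ∗ (P, φP)`: `N` and `P` are subalgebras of `M` which generate `M`,
the state `φ` restricts to `φN`, `φP`, and `N`, `P` are free with respect to `φ`. -/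
structure IsFreeProductDecomposition (M N P : VonNeumannAlgebra H)
    (φ φN φP : Op H → ℂ) : Prop where
  subN : (N : Set (Op H)) ⊆ (M : Set (Op H))
  subP : (P : Set (Op H)) ⊆ (M : Set (Op H))
  generates :
    Set.centralizer (Set.centralizer ((N : Set (Op H)) ∪ (P : Set (Op H)))) = (M : Set (Op H))
  restN : ∀ x ∈ N, φ x = φN x
  restP : ∀ x ∈ P, φ x = φP x
  free : ∀ (n : ℕ) (x : Fin n → Op H) (ε : Fin n → Bool), n ≠ 0 →
    (∀ i, x i ∈ (if ε i then (N : Set (Op H)) else (P : Set (Op H)))) →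
    (∀ i, φ (x i) = 0) →
    (∀ i j : Fin n, (i : ℕ) + 1 = (j : ℕ) → ε i ≠ ε j) →
    φ (List.ofFn x).prod = 0

/-- `f` restricts to a ∗-isomorphism `N ≅ P`. -/
structure IsVNIso (N P : VonNeumannAlgebra H) (f : Op H → Op H) : Prop where
  mem' : ∀ x ∈ N, f x ∈ P
  surj' : ∀ y ∈ P, ∃ x ∈ N, f x = y
  inj' : ∀ x ∈ N, ∀ y ∈ N, f x = f y → x = y
  map_add' : ∀ x ∈ N, ∀ y ∈ N, f (x + y) = f x + f y
  map_smul' : ∀ (c : ℂ), ∀ x ∈ N, f (c • x) = c • f x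
  map_mul' : ∀ x ∈ N, ∀ y ∈ N, f (x * y) = f x * f y
  map_star' : ∀ x ∈ N, f (star x) = star (f x)

/-- `M` satisfies the Haagerup–Størmer conjecture: an automorphism of `M` is pointwise
inner iff it is the composition of an inner automorphism and a modular automorphism
`σ_t^χ` of some faithful normal state `χ`. -/
def SatisfiesHSC (M : VonNeumannAlgebra H) : Prop :=
  ∀ Θ : VNAut M, PointwiseInner Θ ↔
    ∃ (χ : Op H → ℂ) (σ : ℝ → Op H → Op H) (u : Op H) (t : ℝ),
      IsFNState M χ ∧ IsModularFlow M χ σ ∧ IsUnitaryIn (M : Set (Op H)) u ∧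
      ∀ x ∈ M, Θ.toFun x = u * σ t x * star u

/-- `Λ` is a countable subgroup of `ℝ_{>0}`, dense in `ℝ_{>0}`. -/
def IsCountableDenseSubgroup (Λ : Set ℝ) : Prop :=
  Λ ⊆ Set.Ioi (0 : ℝ) ∧ (1 : ℝ) ∈ Λ ∧ (∀ a ∈ Λ, ∀ b ∈ Λ, a * b ∈ Λ) ∧
    (∀ a ∈ Λ, a⁻¹ ∈ Λ) ∧ Λ.Countable ∧ Set.Ioi (0 : ℝ) ⊆ closure Λ

/-- `g` is a character of the (discrete) group `Λ < ℝ_{>0}`, i.e. an element of the dual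
compact group `G = Λ̂` (only the values of `g` on `Λ` are relevant). -/
def IsCharacterOn (Λ : Set ℝ) (g : ℝ → ℂ) : Prop :=
  g 1 = 1 ∧ (∀ a ∈ Λ, ‖g a‖ = 1) ∧ ∀ a ∈ Λ, ∀ b ∈ Λ, g (a * b) = g a * g b

/-- `Φ ∈ E_{M,φ}`: `Φ` is a faithful normal positive linear functional with
`s(φ) ∈ M_Φ` and `Φ s(φ) = s(φ) Φ = φ`. -/
def MemE (M : VonNeumannAlgebra H) (φ Φ : Op H → ℂ) : Prop :=
  IsNormalPLF M Φ ∧ IsFaithfulOn M Φ ∧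
    ∃ p, IsSupportProjOf M φ p ∧ (∀ x ∈ M, Φ (p * x) = Φ (x * p)) ∧
      ∀ x ∈ M, Φ (p * x) = φ x

/-- `w = ([DΨ : DΦ]_t)_t` is the Connes Radon–Nikodym cocycle of the pair `(Ψ, Φ)` of
faithful normal positive functionals (with `σΦ` the modular flow of `Φ`): the unique
σ-strongly continuous family of unitaries satisfying the cocycle identity and the
relative KMS condition. -/
structure IsConnesCocycle (M : VonNeumannAlgebra H) (Φ Ψ : Op H → ℂ)
    (σΦ : ℝ → Op H → Op H) (w : ℝ → Op H) : Prop where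
  unitary' : ∀ t : ℝ, IsUnitaryIn (M : Set (Op H)) (w t)
  cocycle' : ∀ s t : ℝ, w (s + t) = w s * σΦ s (w t)
  continuous' : ∀ ξ : H, Continuous fun t : ℝ => w t ξ
  kms' : ∀ x ∈ M, ∀ y ∈ M, ∃ F : ℂ → ℂ, ContinuousOn F strip ∧
    DifferentiableOn ℂ F stripo ∧ (∃ C : ℝ, ∀ z ∈ strip, ‖F z‖ ≤ C) ∧
    (∀ t : ℝ, F (t : ℂ) = Ψ (w t * σΦ t x * y)) ∧
    (∀ t : ℝ, F ((t : ℂ) + Complex.I) = Φ (y * (w t * σΦ t x)))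

/-- `S` is a strongly dense subset of `M`. -/
def StronglyDenseIn (M : VonNeumannAlgebra H) (S : Set (Op H)) : Prop :=
  S ⊆ (M : Set (Op H)) ∧ ∀ x ∈ M, ∀ ε : ℝ, 0 < ε → ∀ Ξ : Finset H,
    ∃ y ∈ S, ∀ ξ ∈ Ξ, ‖(x - y) ξ‖ < ε

/-- There is a net `(t_j)` in `ℝ` along which `φ(σ_{t_j}^Φ(b^*) w_{t_j}^* s(ψ) a) → 0`
for all `a, b ∈ S` (nets are encoded by maps out of a nontrivially filtered index type). -/
def VanishingNet (φ : Op H → ℂ) (σΦ : ℝ → Op H → Op H) (w : ℝ → Op H)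
    (sψ : Op H) (S : Set (Op H)) : Prop :=
  ∃ (ι : Type) (l : Filter ι), l.NeBot ∧ ∃ t : ι → ℝ,
    ∀ a ∈ S, ∀ b ∈ S,
      Filter.Tendsto (fun j => φ (σΦ (t j) (star b) * (star (w (t j)) * (sψ * a))))
        l (nhds (0 : ℂ))

/-- `(D, π, lam)` is the discrete core `d_{Λ,φ}(M) = M ⋊_{σ^{Λ,φ}} G` of `(M, φ)` with
respect to `Λ = σ_p(Δ_φ)` and `G = Λ̂`: `π` is a normal unital ∗-embedding of `M` into `D`,
`lam` implements `G` by unitaries of `D` satisfying the covariance relation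
`λ_g π(x) λ_g^* = ⟨g, l⟩ π(x)` on `l`-eigenvectors, and `π(M)` together with the `λ_g`
generate `D`. -/
structure IsDiscreteCore {K : Type} [NormedAddCommGroup K] [InnerProductSpace ℂ K]
    [CompleteSpace K] (M : VonNeumannAlgebra H) (σ : ℝ → Op H → Op H)
    (D : VonNeumannAlgebra K) (π : Op H → Op K) (lam : (ℝ → ℂ) → Op K) : Prop where
  mem' : ∀ x ∈ M, π x ∈ D
  inj' : ∀ x ∈ M, ∀ y ∈ M, π x = π y → x = y
  map_one' : π 1 = 1
  map_add' : ∀ x ∈ M, ∀ y ∈ M, π (x + y) = π x + π y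
  map_smul' : ∀ (c : ℂ), ∀ x ∈ M, π (c • x) = c • π x
  map_mul' : ∀ x ∈ M, ∀ y ∈ M, π (x * y) = π x * π y
  map_star' : ∀ x ∈ M, π (star x) = star (π x)
  lam_unitary' : ∀ g, IsCharacterOn (pointSpectrum M σ) g →
    IsUnitaryIn (D : Set (Op K)) (lam g)
  lam_one' : lam (fun _ => 1) = 1
  lam_mul' : ∀ g h, IsCharacterOn (pointSpectrum M σ) g →
    IsCharacterOn (pointSpectrum M σ) h → lam (fun r => g r * h r) = lam g * lam h
  covariance' : ∀ g, IsCharacterOn (pointSpectrum M σ) g →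
    ∀ l ∈ pointSpectrum M σ, ∀ x, IsEigenvector M σ l x →
      lam g * π x * star (lam g) = g l • π x
  generates' : Set.centralizer (Set.centralizer
      ((π '' (M : Set (Op H))) ∪ (lam '' {g | IsCharacterOn (pointSpectrum M σ) g})))
    = (D : Set (Op K))


/-! ### Elementary facts on von Neumann algebras -/

section Basic

variable {M : VonNeumannAlgebra H} {φ : Op H → ℂ}

theorem vn_smul_mem (c : ℂ) {x : Op H} (hx : x ∈ M) : c • x ∈ M :=
  M.toStarSubalgebra.toSubalgebra.smul_mem hx c

theorem vn_mem_of_commute {x : Op H} (h : ∀ y ∈ M.commutant, Commute y x) : x ∈ M := by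
  rw [← M.commutant_commutant, VonNeumannAlgebra.mem_commutant_iff]
  exact h

theorem vn_commute {x y : Op H} (hx : x ∈ M) (hy : y ∈ M.commutant) : Commute x y :=
  VonNeumannAlgebra.mem_commutant_iff.1 hy x hx

theorem vn_cfc_mem {x : Op H} (hx : x ∈ M) (f : ℝ → ℝ) : cfc f x ∈ M :=
  vn_mem_of_commute fun _ hy => ((vn_commute hx hy).cfc_real f).symm

theorem vn_isClosed (M : VonNeumannAlgebra H) : IsClosed (M : Set (Op H)) := by
  rw [← M.centralizer_centralizer]
  exact Set.isClosed_centralizer _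

/-- Every positive element of a von Neumann algebra is of the form `b* b` inside it. -/
theorem vn_exists_star_mul_self {x : Op H} (hx : x ∈ M) (h : 0 ≤ x) :
    ∃ b ∈ M, star b * b = x := by
  refine ⟨cfc Real.sqrt x, vn_cfc_mem hx _, ?_⟩
  have hsa : IsSelfAdjoint x := .of_nonneg h
  rw [(cfc_predicate Real.sqrt x : IsSelfAdjoint _).star_eq,
    ← cfc_mul Real.sqrt Real.sqrt x]
  conv_rhs => rw [← cfc_id ℝ x]
  refine cfc_congr fun t ht => ?_
  exact Real.mul_self_sqrt (spectrum_nonneg_of_nonneg h ht)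

/-! ### Positive linear functionals -/

namespace IsPLF

theorem map_zero (h : IsPLF M φ) : φ 0 = 0 := by
  simpa using h.map_smul 0 0 M.zero_mem'

theorem map_neg (h : IsPLF M φ) {x : Op H} (hx : x ∈ M) : φ (-x) = -φ x := by
  simpa using h.map_smul (-1) x hx

theorem map_sub (h : IsPLF M φ) {x y : Op H} (hx : x ∈ M) (hy : y ∈ M) :
    φ (x - y) = φ x - φ y := by
  rw [sub_eq_add_neg, h.map_add x hx _ (neg_mem hy), h.map_neg hy, sub_eq_add_neg]

theorem map_sum (h : IsPLF M φ) {ι : Type*} (s : Finset ι) (f : ι → Op H)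
    (hf : ∀ i ∈ s, f i ∈ M) : φ (∑ i ∈ s, f i) = ∑ i ∈ s, φ (f i) := by
  classical
  induction s using Finset.induction_on with
  | empty => simpa using h.map_zero
  | insert a s ha ih =>
    rw [Finset.sum_insert ha, Finset.sum_insert ha, h.map_add _ (hf a (by simp)) _
      (sum_mem fun i hi => hf i (by simp [hi])), ih fun i hi => hf i (by simp [hi])]

theorem nonneg (h : IsPLF M φ) {x : Op H} (hx : x ∈ M) (h0 : 0 ≤ x) : 0 ≤ φ x := by
  obtain ⟨b, hb, rfl⟩ := vn_exists_star_mul_self hx h0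
  exact h.pos b hb

theorem mono (h : IsPLF M φ) {x y : Op H} (hx : x ∈ M) (hy : y ∈ M) (h0 : x ≤ y) :
    φ x ≤ φ y := by
  rw [← sub_nonneg, ← h.map_sub hy hx]
  exact h.nonneg (sub_mem hy hx) (sub_nonneg.2 h0)

theorem map_star_mul (h : IsPLF M φ) {x y : Op H} (hx : x ∈ M) (hy : y ∈ M) :
    φ (star y * x) = star (φ (star x * y)) := by
  have key : ∀ c : ℂ, (c * φ (star y * x) + star c * φ (star x * y)).im = 0 := by
    intro c
    have hc := vn_smul_mem c hx
    have h1 := h.pos _ (add_mem hy hc)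
    have h2 := h.pos _ hy
    have h3 := h.pos _ hc
    have e : star (y + c • x) * (y + c • x) =
        (star y * y + star (c • x) * (c • x)) + (c • (star y * x) + star c • (star x * y)) := by
      simp only [star_add, add_mul, mul_add, star_smul, mul_smul_comm, smul_mul_assoc, smul_add]
      rw [smul_comm c]
      abel
    have m1 := mul_mem (star_mem hy) hx
    have m2 := mul_mem (star_mem hx) hy
    rw [e, h.map_add _ (add_mem (mul_mem (star_mem hy) hy) (mul_mem (star_mem hc) hc)) _
      (add_mem (vn_smul_mem _ m1) (vn_smul_mem _ m2)),
      h.map_add _ (mul_mem (star_mem hy) hy) _ (mul_mem (star_mem hc) hc),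
      h.map_add _ (vn_smul_mem _ m1) _ (vn_smul_mem _ m2), h.map_smul _ _ m1,
      h.map_smul _ _ m2] at h1
    have i1 := (Complex.le_def.1 h1).2
    have i2 := (Complex.le_def.1 h2).2
    have i3 := (Complex.le_def.1 h3).2
    simp only [Complex.add_im, Complex.zero_im] at i1 i2 i3 ⊢
    linarith
  have k1 := key 1
  have k2 := key Complex.I
  apply Complex.ext <;> simp at k1 k2 ⊢ <;> linarith

theorem map_star (h : IsPLF M φ) {x : Op H} (hx : x ∈ M) : φ (star x) = star (φ x) := by
  simpa using h.map_star_mul (one_mem M) hx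

/-- The (degenerate) inner product attached to a positive linear functional. -/
noncomputable abbrev core (h : IsPLF M φ) : PreInnerProductSpace.Core ℂ M.toStarSubalgebra where
  inner y x := φ (star (y : Op H) * x)
  conj_inner_symm x y := (h.map_star_mul y.2 x.2).symm
  re_inner_nonneg x := (Complex.le_def.1 (h.pos x x.2)).1
  add_left x y z := by
    simp only [AddMemClass.coe_add, star_add, add_mul]
    exact h.map_add _ (mul_mem (star_mem x.2) z.2) _ (mul_mem (star_mem y.2) z.2)
  smul_left x y c := by
    have : star ((c • x : M.toStarSubalgebra) : Op H) * (y : Op H)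
        = star c • (star (x : Op H) * y) := by simp
    rw [this, h.map_smul _ _ (mul_mem (star_mem x.2) y.2)]
    rfl

theorem cauchy_schwarz (h : IsPLF M φ) {x y : Op H} (hx : x ∈ M) (hy : y ∈ M) :
    ‖φ (y * x)‖ ^ 2 ≤ (φ (y * star y)).re * (φ (star x * x)).re := by
  let := h.core
  have := InnerProductSpace.Core.inner_mul_inner_self_le (𝕜 := ℂ) (F := M.toStarSubalgebra)
    ⟨star y, star_mem hy⟩ ⟨x, hx⟩
  change ‖φ (star (star y) * x)‖ * ‖φ (star x * star y)‖ ≤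
    (φ (star (star y) * star y)).re * (φ (star x * x)).re at this
  have e : φ (star x * star y) = star (φ (y * x)) := by
    rw [← star_mul, h.map_star (mul_mem hy hx)]
  rw [e, star_star, norm_star] at this
  rwa [sq]

theorem re_nonneg (h : IsPLF M φ) {x : Op H} (hx : x ∈ M) : 0 ≤ (φ (star x * x)).re :=
  (Complex.le_def.1 (h.pos x hx)).1

theorem eq_re (h : IsPLF M φ) {x : Op H} (hx : x ∈ M) :
    φ (star x * x) = ((φ (star x * x)).re : ℂ) := by
  have := (Complex.le_def.1 (h.pos x hx)).2
  exact Complex.ext (by simp) (by simpa using this.symm)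

theorem one_re_nonneg (h : IsPLF M φ) : 0 ≤ (φ 1).re := by
  simpa using h.re_nonneg (one_mem M)

theorem re_le (h : IsPLF M φ) {x y : Op H} (hx : x ∈ M) (hy : y ∈ M) (h0 : x ≤ y) :
    (φ x).re ≤ (φ y).re := (Complex.le_def.1 (h.mono hx hy h0)).1

theorem star_mul_self_le (h : IsPLF M φ) {x : Op H} (hx : x ∈ M) :
    (φ (star x * x)).re ≤ ‖x‖ ^ 2 * (φ 1).re := by
  have h1 : star x * x ≤ ((‖x‖ ^ 2 : ℝ) : ℂ) • (1 : Op H) := by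
    have := CStarAlgebra.star_mul_le_algebraMap_norm_sq (a := x)
    rwa [Algebra.algebraMap_eq_smul_one, ← Complex.coe_smul] at this
  have := h.re_le (mul_mem (star_mem hx) hx) (vn_smul_mem _ (one_mem M)) h1
  rw [h.map_smul _ _ (one_mem M), Complex.re_ofReal_mul] at this
  exact this

theorem norm_le (h : IsPLF M φ) {x : Op H} (hx : x ∈ M) : ‖φ x‖ ≤ (φ 1).re * ‖x‖ := by
  have h1 := h.cauchy_schwarz hx (one_mem M)
  have h2 := h.star_mul_self_le hx
  have h3 := h.one_re_nonneg
  simp only [one_mul, star_one] at h1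
  refine abs_le_of_sq_le_sq' (a := ‖φ x‖) ?_ (by positivity) |>.2
  calc ‖φ x‖ ^ 2 ≤ _ := h1
    _ ≤ (φ 1).re * (‖x‖ ^ 2 * (φ 1).re) := by gcongr
    _ = _ := by ring

theorem add {ω : Op H → ℂ} (h : IsPLF M φ) (h' : IsPLF M ω) : IsPLF M (fun x => φ x + ω x) where
  map_add x hx y hy := by simp only [h.map_add x hx y hy, h'.map_add x hx y hy]; ring
  map_smul c x hx := by simp only [h.map_smul c x hx, h'.map_smul c x hx]; ring
  pos x hx := add_nonneg (h.pos x hx) (h'.pos x hx)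

/-- A positive functional agrees on `M` with a bounded functional on all of `B(H)`. -/
theorem exists_clm (h : IsPLF M φ) : ∃ f : Op H →L[ℂ] ℂ, ∀ x ∈ M, f x = φ x := by
  let p : Submodule ℂ (Op H) := M.toStarSubalgebra.toSubalgebra.toSubmodule
  let g : StrongDual ℂ p := LinearMap.mkContinuous
    { toFun := fun x => φ x
      map_add' := fun x y => h.map_add _ x.2 _ y.2
      map_smul' := fun c x => h.map_smul c _ x.2 } (φ 1).re (fun x => h.norm_le x.2)
  obtain ⟨f, hf, -⟩ := exists_extension_norm_eq p g
  exact ⟨f, fun x hx => hf ⟨x, hx⟩⟩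

end IsPLF

end Basic

/-! ### Projections -/

section Projections

variable {M : VonNeumannAlgebra H}

namespace IsProjIn

variable {p q : Op H}

theorem inner_apply (h : IsProjIn (M : Set (Op H)) p) (ξ η : H) :
    inner ℂ (p ξ) η = inner ℂ ξ (p η) := by
  have h1 := ContinuousLinearMap.adjoint_inner_left p η ξ
  rwa [← ContinuousLinearMap.star_eq_adjoint, h.2.1] at h1

theorem inner_self (h : IsProjIn (M : Set (Op H)) p) (ξ : H) :
    inner ℂ (p ξ) ξ = ((‖p ξ‖ ^ 2 : ℝ) : ℂ) := by
  conv_lhs => rw [← h.2.2, mul_apply_eq_comp, h.inner_apply]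
  rw [inner_self_eq_norm_sq_to_K]
  norm_cast

theorem norm_apply_le (h : IsProjIn (M : Set (Op H)) p) (ξ : H) : ‖p ξ‖ ≤ ‖ξ‖ := by
  have h1 : ‖p ξ‖ ^ 2 ≤ ‖p ξ‖ * ‖ξ‖ := by
    have := norm_inner_le_norm (𝕜 := ℂ) (p ξ) ξ
    rw [h.inner_self, Complex.norm_real, Real.norm_of_nonneg (by positivity)] at this
    exact this
  by_contra! h2
  nlinarith [norm_nonneg ξ]

theorem mul_eq_zero_symm (hp : IsProjIn (M : Set (Op H)) p) (hq : IsProjIn (M : Set (Op H)) q)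
    (h : p * q = 0) : q * p = 0 := by
  simpa [hp.2.1, hq.2.1] using congr(star $h)

theorem mul_eq_symm (hp : IsProjIn (M : Set (Op H)) p) (hq : IsProjIn (M : Set (Op H)) q)
    (h : p * q = q) : q * p = q := by
  simpa [hp.2.1, hq.2.1] using congr(star $h)

theorem one_sub (hp : IsProjIn (M : Set (Op H)) p) : IsProjIn (M : Set (Op H)) (1 - p) := by
  refine ⟨sub_mem (one_mem M) hp.1, by simp [hp.2.1], ?_⟩
  simp [mul_sub, sub_mul, hp.2.2]

theorem add (hp : IsProjIn (M : Set (Op H)) p) (hq : IsProjIn (M : Set (Op H)) q)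
    (h : p * q = 0) : IsProjIn (M : Set (Op H)) (p + q) := by
  refine ⟨add_mem (S := VonNeumannAlgebra H) hp.1 hq.1, by simp [hp.2.1, hq.2.1], ?_⟩
  simp [mul_add, add_mul, hp.2.2, hq.2.2, h, hp.mul_eq_zero_symm hq h]

theorem sub (hp : IsProjIn (M : Set (Op H)) p) (hq : IsProjIn (M : Set (Op H)) q)
    (h : p * q = q) : IsProjIn (M : Set (Op H)) (p - q) := by
  refine ⟨sub_mem (S := VonNeumannAlgebra H) hp.1 hq.1, by simp [hp.2.1, hq.2.1], ?_⟩
  simp [mul_sub, sub_mul, hp.2.2, hq.2.2, h, hp.mul_eq_symm hq h]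

theorem nonneg (hp : IsProjIn (M : Set (Op H)) p) : 0 ≤ p := by
  have : star p * p = p := by rw [hp.2.1, hp.2.2]
  rw [← this]
  exact star_mul_self_nonneg p

theorem finset_sum {ι : Type*} {p : ι → Op H} (hp : ∀ i, IsProjIn (M : Set (Op H)) (p i))
    (ho : Pairwise fun i j => p i * p j = 0) (s : Finset ι) :
    IsProjIn (M : Set (Op H)) (∑ i ∈ s, p i) := by
  classical
  induction s using Finset.induction_on with
  | empty => exact ⟨M.zero_mem', by simp, by simp⟩
  | insert a s ha ih =>
    rw [Finset.sum_insert ha]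
    refine (hp a).add ih ?_
    rw [Finset.mul_sum]
    exact Finset.sum_eq_zero fun i hi => ho (by rintro rfl; exact ha hi)

end IsProjIn

/-- The range projection of a self-adjoint element of a von Neumann algebra. -/
theorem exists_range_projection {a : Op H} (ha : a ∈ M) (hsa : star a = a) :
    ∃ e, IsProjIn (M : Set (Op H)) e ∧ e * a = a ∧ a * e = a ∧ (∀ y, a * y = 0 → e * y = 0) ∧
      ∀ y, Commute a y → Commute e y := by
  set U : Submodule ℂ H := a.ker with hU
  have : CompleteSpace U := (ContinuousLinearMap.isClosed_ker a).completeSpace_coe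
  set f : Op H := U.starProjection with hf
  have fU (ξ : H) : a (f ξ) = 0 := by
    have h : f ξ ∈ a.ker := U.starProjection_apply_mem ξ
    exact h
  have fe {ξ : H} (h : a ξ = 0) : f ξ = ξ :=
    Submodule.starProjection_eq_self_iff.2 h
  have fs : star f = f := isSelfAdjoint_starProjection U
  have ff : f * f = f := U.isIdempotentElem_starProjection
  have af : a * f = 0 := ContinuousLinearMap.ext fU
  have fa : f * a = 0 := by simpa [fs, hsa] using congr(star $af)
  have half {y : Op H} (h : Commute a y) : f * y * f = y * f := by
    refine ContinuousLinearMap.ext fun ξ => fe ?_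
    have := congr($(h.eq) (f ξ))
    simpa [fU] using this
  have comm {y : Op H} (h : Commute a y) : Commute f y := by
    have h1 := half h
    have h2 := half (y := star y) (by
      have := h.star_star
      rwa [hsa] at this)
    have h3 := congr(star $h2)
    simp only [star_mul, star_star, fs] at h3
    rw [← mul_assoc, h1] at h3
    exact h3.symm
  have comm' {y : Op H} (h : Commute a y) : Commute (1 - f) y :=
    (Commute.one_left y).sub_left (comm h)
  refine ⟨1 - f, ⟨vn_mem_of_commute fun y hy => (comm' (vn_commute ha hy)).symm, by simp [fs],
    by simp [mul_sub, sub_mul, ff]⟩, by simp [sub_mul, fa], by simp [mul_sub, af],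
    fun y hy => ?_, fun y hy => comm' hy⟩
  rw [sub_mul, one_mul, sub_eq_zero]
  refine ContinuousLinearMap.ext fun ξ => (fe ?_).symm
  exact congr($hy ξ)

/-- Pairwise orthogonal projections of a von Neumann algebra have a sum in it. -/
theorem exists_orthogonal_sum {ι : Type} {p : ι → Op H}
    (hp : ∀ i, IsProjIn (M : Set (Op H)) (p i)) (ho : Pairwise fun i j => p i * p j = 0) :
    ∃ q, IsProjIn (M : Set (Op H)) q ∧ (∀ ξ, HasSum (fun i => p i ξ) (q ξ)) ∧
      ∀ i, q * p i = p i := by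
  classical
  have bd (s : Finset ι) (ξ : H) : ‖∑ i ∈ s, p i ξ‖ ≤ ‖ξ‖ := by
    have := (IsProjIn.finset_sum hp ho s).norm_apply_le ξ
    simpa using this
  have bessel (s : Finset ι) (ξ : H) : ∑ i ∈ s, ‖p i ξ‖ ^ 2 ≤ ‖ξ‖ ^ 2 := by
    have h1 := (IsProjIn.finset_sum hp ho s).inner_self ξ
    simp only [sum_apply, sum_inner, (hp _).inner_self] at h1
    rw [← Complex.ofReal_sum, Complex.ofReal_inj] at h1
    rw [h1]
    gcongr
    exact bd s ξ
  have orth : OrthogonalFamily ℂ (fun i => (p i).range) fun i => (p i).range.subtypeₗᵢ := by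
    intro i j hij v w
    obtain ⟨_, x, rfl⟩ := v
    obtain ⟨_, y, rfl⟩ := w
    change inner ℂ (p i x) (p j y) = 0
    rw [(hp i).inner_apply, ← mul_apply_eq_comp, ho hij]
    simp
  have summ (ξ : H) : Summable fun i => p i ξ := by
    have h1 := (orth.summable_iff_norm_sq_summable
      (fun i => ⟨p i ξ, ⟨ξ, rfl⟩⟩)).2 (summable_of_sum_le (fun _ => by positivity)
        (fun s => bessel s ξ))
    exact h1
  let q : Op H := LinearMap.mkContinuous
    { toFun := fun ξ => ∑' i, p i ξ
      map_add' := fun ξ η => by simp only [map_add]; exact (summ ξ).tsum_add (summ η)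
      map_smul' := fun c ξ => by simp only [map_smul]; exact (summ ξ).tsum_const_smul c } 1
      (fun ξ => by
        rw [one_mul]
        exact le_of_tendsto ((summ ξ).hasSum.norm) (.of_forall fun s => bd s ξ))
  have hq (ξ : H) : HasSum (fun i => p i ξ) (q ξ) := (summ ξ).hasSum
  have qp (i : ι) : q * p i = p i := by
    refine ContinuousLinearMap.ext fun ξ => (hq (p i ξ)).unique ?_
    have h1 := hasSum_single (f := fun j => p j (p i ξ)) i fun j hj => by
      rw [← mul_apply_eq_comp, ho hj]; rfl
    rwa [← mul_apply_eq_comp, (hp i).2.2] at h1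
  refine ⟨q, ⟨?_, ?_, ?_⟩, hq, qp⟩
  · refine vn_mem_of_commute (M := M) fun y hy => ContinuousLinearMap.ext fun ξ => ?_
    have h1 : (fun i => y (p i ξ)) = fun i => p i (y ξ) :=
      funext fun i => congr($((vn_commute (hp i).1 hy).eq) ξ).symm
    exact (h1 ▸ (hq ξ).mapL y).unique (hq (y ξ))
  · rw [ContinuousLinearMap.star_eq_adjoint]
    refine (ContinuousLinearMap.eq_adjoint_iff _ _).2 (fun ξ η => ?_) |>.symm
    have h1 := (hq ξ).mapL ((innerSL ℂ).flip η)
    have h2 := (hq η).mapL (innerSL ℂ ξ)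
    simp only [ContinuousLinearMap.flip_apply, innerSL_apply_apply, (hp _).inner_apply] at h1 h2
    exact h1.unique h2
  · refine ContinuousLinearMap.ext fun ξ => ((hq ξ).mapL q).unique ?_
    convert hq ξ using 2 with i
    exact congr($(qp i) ξ)

/-- Below a projection `e`, a maximal orthogonal family of nonzero projections with property `Q`. -/
theorem exists_maximal_orthogonal (M : VonNeumannAlgebra H) (e : Op H) (Q : Op H → Prop) :
    ∃ (S : Set (Op H)) (s : Op H),
      (∀ p ∈ S, IsProjIn (M : Set (Op H)) p ∧ p ≠ 0 ∧ e * p = p ∧ Q p) ∧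
      (Pairwise fun i j : S => (i : Op H) * j = 0) ∧ IsProjIn (M : Set (Op H)) s ∧ e * s = s ∧
      (∀ ξ, HasSum (fun i : S => (i : Op H) ξ) (s ξ)) ∧
      ∀ r, IsProjIn (M : Set (Op H)) r → e * r = r → s * r = 0 → Q r → r = 0 := by
  let F : Set (Set (Op H)) := {S | (∀ p ∈ S, IsProjIn (M : Set (Op H)) p ∧ p ≠ 0 ∧ e * p = p ∧ Q p)
    ∧ S.Pairwise fun i j => i * j = 0}
  obtain ⟨S, hS⟩ : ∃ S, Maximal (· ∈ F) S := by
    refine zorn_subset F fun c hc hch => ⟨⋃₀ c, ⟨fun p ⟨t, ht, hpt⟩ => (hc ht).1 p hpt, ?_⟩,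
      fun t ht => Set.subset_sUnion_of_mem ht⟩
    exact (Set.pairwise_sUnion hch.directedOn).2 fun t ht => (hc ht).2
  have ho : Pairwise fun i j : S => (i : Op H) * j = 0 := fun i j hij =>
    hS.prop.2 i.2 j.2 fun h => hij (Subtype.ext h)
  obtain ⟨s, hs, hsum, hsp⟩ := exists_orthogonal_sum
    (fun i : S => (hS.prop.1 i i.2).1) ho
  refine ⟨S, s, hS.prop.1, ho, hs, ?_, hsum, fun r hr her hsr hQ => ?_⟩
  · refine ContinuousLinearMap.ext fun ξ => ((hsum ξ).mapL e).unique ?_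
    convert hsum ξ using 2 with i
    exact congr($((hS.prop.1 i i.2).2.2.1) ξ)
  · by_contra h0
    have h1 (p) (hp : p ∈ S) : r * p = 0 := by
      rw [← show s * p = p from hsp ⟨p, hp⟩, ← mul_assoc, hs.mul_eq_zero_symm hr hsr, zero_mul]
    have h2 : insert r S ∈ F := by
      refine ⟨?_, ?_⟩
      · rintro p (rfl | hp)
        · exact ⟨hr, h0, her, hQ⟩
        · exact hS.prop.1 p hp
      · refine (Set.pairwise_insert).2 ⟨hS.prop.2, fun p hp _ => ⟨h1 p hp, ?_⟩⟩
        exact hr.mul_eq_zero_symm (hS.prop.1 p hp).1 (h1 p hp)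
    have h3 : r ∈ S := hS.le_of_ge h2 (Set.subset_insert r S) (Set.mem_insert r S)
    exact h0 (by rw [← hr.2.2]; exact h1 r h3)

end Projections

/-! ### Normal functionals are locally dominated by vector functionals -/

section Domination

variable {M : VonNeumannAlgebra H} {φ ω : Op H → ℂ}

theorem op_smul_nonneg {c : ℝ} (hc : 0 ≤ c) {x : Op H} (hx : 0 ≤ x) : 0 ≤ (c : ℂ) • x := by
  rw [ContinuousLinearMap.nonneg_iff_isPositive] at hx ⊢
  exact hx.smul_of_nonneg (by exact_mod_cast hc)

theorem isProjIn_conj_nonneg {e x : Op H} (he : IsProjIn (M : Set (Op H)) e) (hx : 0 ≤ x) :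
    0 ≤ e * x * e := by
  simpa [he.2.1] using star_left_conjugate_nonneg hx e

theorem exists_spectral_cut {x : Op H} (hx : x ∈ M) (hsa : IsSelfAdjoint x) (c : ℝ) :
    ∃ e, IsProjIn (M : Set (Op H)) e ∧ (∀ y, Commute x y → Commute e y) ∧
      0 ≤ e * (x - (c : ℂ) • 1) ∧ (1 - e) * (x - (c : ℂ) • 1) ≤ 0 := by
  set a : Op H := cfc (fun t : ℝ => max (t - c) 0) x with ha
  set b : Op H := cfc (fun t : ℝ => max (c - t) 0) x with hb
  have ab : a * b = 0 := by
    rw [ha, hb, ← cfc_mul _ _ x]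
    rw [← cfc_zero ℝ x]
    refine cfc_congr fun t _ => ?_
    rcases le_total t c with h | h
    · simp [max_eq_right (sub_nonpos.2 h)]
    · simp [max_eq_right (sub_nonpos.2 h)]
  have sub : x - (c : ℂ) • 1 = a - b := by
    rw [ha, hb, ← cfc_sub _ _ x]
    have : (fun t : ℝ => max (t - c) 0 - max (c - t) 0) = fun t => t - c := by
      funext t
      rcases le_total t c with h | h
      · rw [max_eq_right (sub_nonpos.2 h), max_eq_left (sub_nonneg.2 h)]; ring
      · rw [max_eq_left (sub_nonneg.2 h), max_eq_right (sub_nonpos.2 h)]; ring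
    rw [this, cfc_sub (fun t => t) (fun _ => c) x, cfc_id' ℝ x, cfc_const c x,
      Algebra.algebraMap_eq_smul_one, ← Complex.coe_smul]
  have a0 : 0 ≤ a := cfc_nonneg fun t _ => le_max_right _ _
  have b0 : 0 ≤ b := cfc_nonneg fun t _ => le_max_right _ _
  obtain ⟨e, he, ea, -, ey, ec⟩ := exists_range_projection (vn_cfc_mem hx _ : a ∈ M)
    (IsSelfAdjoint.of_nonneg a0).star_eq
  have eb : e * b = 0 := ey b ab
  refine ⟨e, he, fun y hy => ec y (hy.cfc_real _), ?_, ?_⟩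
  · rwa [sub, mul_sub, ea, eb, sub_zero]
  · have h1 : (1 - e) * (a - b) = -b := by
      rw [sub_mul, mul_sub e, ea, eb, one_mul]
      abel
    rw [sub, h1]
    exact neg_nonpos.2 b0

theorem IsPLF.re_add_le (h : IsPLF M φ) {x y : Op H} (hx : x ∈ M) (hy : y ∈ M) :
    (φ (star (x + y) * (x + y))).re ≤
      2 * (φ (star x * x)).re + 2 * (φ (star y * y)).re := by
  have h1 := h.re_nonneg (sub_mem hx hy)
  have m := fun {a b : Op H} (ha : a ∈ M) (hb : b ∈ M) => mul_mem (star_mem ha) hb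
  have e1 : φ (star (x + y) * (x + y)) =
      φ (star x * x) + φ (star x * y) + (φ (star y * x) + φ (star y * y)) := by
    rw [← h.map_add _ (m hx hx) _ (m hx hy), ← h.map_add _ (m hy hx) _ (m hy hy),
      ← h.map_add _ (add_mem (m hx hx) (m hx hy)) _ (add_mem (m hy hx) (m hy hy))]
    simp only [add_mul, mul_add, star_add]
    abel_nf
  have e2 : φ (star (x - y) * (x - y)) =
      φ (star x * x) - φ (star x * y) - (φ (star y * x) - φ (star y * y)) := by
    rw [← h.map_sub (m hx hx) (m hx hy), ← h.map_sub (m hy hx) (m hy hy),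
      ← h.map_sub (sub_mem (m hx hx) (m hx hy)) (sub_mem (m hy hx) (m hy hy))]
    simp only [sub_mul, mul_sub, star_sub]
    abel_nf
  rw [e2] at h1
  rw [e1]
  simp only [Complex.add_re, Complex.sub_re] at h1 ⊢
  linarith

theorem re_inner_nonneg_of_nonneg {x : Op H} (hx : 0 ≤ x) (ξ : H) :
    0 ≤ (inner ℂ (x ξ) ξ).re :=
  ((ContinuousLinearMap.nonneg_iff_isPositive x).1 hx).re_inner_nonneg_left ξ

theorem le_vector_of_le_on_projections_aux (h : IsPLF M φ) {p : Op H}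
    (hp : IsProjIn (M : Set (Op H)) p) {ξ : H}
    (hle : ∀ q, IsProjIn (M : Set (Op H)) q → p * q = q → (φ q).re ≤ (inner ℂ (q ξ) ξ).re) (k : ℕ) :
    ∀ c : ℝ, 0 < c → ∀ x ∈ M, 0 ≤ x → p * x = x → x ≤ (c : ℂ) • 1 →
      (φ x).re - (inner ℂ (x ξ) ξ).re ≤ c * (1 / 2) ^ k * (φ 1).re := by
  induction k with
  | zero =>
    intro c hc x hx h0 _ hxc
    have h1 := h.re_le hx (vn_smul_mem _ (one_mem M)) hxc
    rw [h.map_smul _ _ (one_mem M), Complex.re_ofReal_mul] at h1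
    have h2 := re_inner_nonneg_of_nonneg h0 ξ
    simp
    linarith
  | succ k ih =>
    intro c hc x hx h0 hpx hxc
    have hsa : IsSelfAdjoint x := .of_nonneg h0
    have hxp : x * p = x := by simpa [hsa.star_eq, hp.2.1] using congr(star $hpx)
    obtain ⟨e, he, ec, e1, e2⟩ := exists_spectral_cut hx hsa (c / 2)
    have hex : e * x = x * e := ec x (Commute.refl x)
    have hpe : p * e = e := by
      have hpr := hp.one_sub
      have h1 := isProjIn_conj_nonneg hpr e1
      have h2 : (1 - p) * (e * (x - ((c / 2 : ℝ) : ℂ) • 1)) * (1 - p) =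
          -(((c / 2 : ℝ) : ℂ) • ((1 - p) * e * (1 - p))) := by
        have : (x - ((c / 2 : ℝ) : ℂ) • 1) * (1 - p) = -(((c / 2 : ℝ) : ℂ) • (1 - p)) := by
          simp only [sub_mul, mul_sub, hxp, mul_one, smul_mul_assoc, one_mul, smul_sub]
          abel
        rw [mul_assoc (1 - p), mul_assoc e, this, mul_neg, mul_neg, mul_smul_comm, mul_smul_comm,
          mul_assoc]
      rw [h2] at h1
      have h3 := op_smul_nonneg (by positivity : (0 : ℝ) ≤ c / 2)
        (isProjIn_conj_nonneg hpr he.nonneg)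
      have h4 := le_antisymm (neg_nonneg.1 h1) h3
      have h5 : (1 - p) * e * (1 - p) = 0 :=
        (smul_eq_zero.1 h4).resolve_left (by exact_mod_cast (by positivity : c / 2 ≠ 0))
      have h6 : (e * (1 - p)) = 0 := by
        rw [← CStarRing.star_mul_self_eq_zero_iff, star_mul, he.2.1, hpr.2.1, mul_assoc,
          ← mul_assoc e, he.2.2, ← mul_assoc, h5]
      have h7 : e * p = e := by
        rw [mul_sub, mul_one, sub_eq_zero] at h6
        exact h6.symm
      simpa [he.2.1, hp.2.1] using congr(star $h7)
    set x' : Op H := x - ((c / 2 : ℝ) : ℂ) • e with hx'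
    have m' : x' ∈ M := sub_mem hx (vn_smul_mem _ he.1)
    have n1 : 0 ≤ x' := by
      have : x' = e * (x - ((c / 2 : ℝ) : ℂ) • 1) + (1 - e) * x * (1 - e) := by
        have h1 : (1 - e) * x * (1 - e) = x - x * e := by
          simp only [sub_mul, mul_sub, one_mul, mul_one, hex]
          rw [mul_assoc x e e, he.2.2]
          abel
        rw [h1, hx', mul_sub, hex, mul_smul_comm, mul_one]
        abel
      rw [this]
      exact add_nonneg e1 (isProjIn_conj_nonneg he.one_sub h0)
    have n2 : x' ≤ ((c / 2 : ℝ) : ℂ) • 1 := by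
      have : ((c / 2 : ℝ) : ℂ) • 1 - x' =
          -((1 - e) * (x - ((c / 2 : ℝ) : ℂ) • 1)) + e * ((c : ℂ) • 1 - x) * e := by
        have h1 : e * ((c : ℂ) • 1 - x) * e = (c : ℂ) • e - e * x := by
          rw [mul_sub, sub_mul, mul_assoc e x e, ← hex, ← mul_assoc, he.2.2]
          simp only [mul_smul_comm, mul_one, smul_mul_assoc, he.2.2]
        rw [h1]
        simp only [hx', sub_mul, mul_sub, mul_smul_comm, mul_one, one_mul]
        push_cast
        module
      rw [← sub_nonneg, this]
      exact add_nonneg (neg_nonneg.2 e2) (isProjIn_conj_nonneg he (sub_nonneg.2 hxc))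
    have h1 := ih (c / 2) (by positivity) x' m' n1
      (by rw [hx', mul_sub, hpx, mul_smul_comm, hpe]) n2
    have h2 := hle e he hpe
    rw [hx', h.map_sub hx (vn_smul_mem _ he.1), h.map_smul _ _ he.1] at h1
    simp only [sub_apply, smul_apply, inner_sub_left,
      inner_smul_left, Complex.conj_ofReal, Complex.sub_re, Complex.re_ofReal_mul] at h1
    have h3 : c / 2 * (φ e).re ≤ c / 2 * (inner ℂ (e ξ) ξ).re := by gcongr
    rw [pow_succ]
    linarith

theorem le_vector_of_le_on_projections (h : IsPLF M φ) {p : Op H}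
    (hp : IsProjIn (M : Set (Op H)) p) {ξ : H}
    (hle : ∀ q, IsProjIn (M : Set (Op H)) q → p * q = q → (φ q).re ≤ (inner ℂ (q ξ) ξ).re)
    {x : Op H} (hx : x ∈ M) :
    (φ (p * (star x * x) * p)).re ≤ ‖x (p ξ)‖ ^ 2 := by
  set y := p * (star x * x) * p with hy
  have my : y ∈ M := mul_mem (mul_mem hp.1 (mul_mem (star_mem hx) hx)) hp.1
  have y0 : 0 ≤ y := isProjIn_conj_nonneg hp (star_mul_self_nonneg x)
  have hin : (inner ℂ (y ξ) ξ).re = ‖x (p ξ)‖ ^ 2 := by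
    have : inner ℂ (y ξ) ξ = inner ℂ (x (p ξ)) (x (p ξ)) := by
      simp only [hy, mul_apply_eq_comp, hp.inner_apply]
      rw [ContinuousLinearMap.star_eq_adjoint, ContinuousLinearMap.adjoint_inner_left]
    rw [this, ← inner_self_eq_norm_sq (𝕜 := ℂ)]
    rfl
  rw [← hin]
  have hyc : y ≤ ((‖y‖ + 1 : ℝ) : ℂ) • 1 := by
    have h1 := (IsSelfAdjoint.of_nonneg y0).le_algebraMap_norm_self
    rw [Algebra.algebraMap_eq_smul_one, ← Complex.coe_smul] at h1
    refine h1.trans ?_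
    rw [← sub_nonneg, ← sub_smul]
    push_cast
    simp
  have key := fun k => le_vector_of_le_on_projections_aux h hp hle k (‖y‖ + 1) (by positivity) y my
    y0 (by rw [hy, ← mul_assoc, ← mul_assoc, hp.2.2]) hyc
  rw [← sub_nonpos]
  refine ge_of_tendsto' (f := fun k : ℕ => (‖y‖ + 1) * (1 / 2) ^ k * (φ 1).re) (x := Filter.atTop)
    ?_ key
  have h1 := tendsto_pow_atTop_nhds_zero_of_lt_one (r := (1 / 2 : ℝ)) (by norm_num) (by norm_num)
  simpa using (h1.const_mul (‖y‖ + 1)).mul_const (φ 1).re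

theorem hasSum_re_inner {ι : Type} {p : ι → Op H} {q : Op H}
    (h : ∀ ξ, HasSum (fun i => p i ξ) (q ξ)) (ξ : H) :
    HasSum (fun i => (inner ℂ (p i ξ) ξ).re) (inner ℂ (q ξ) ξ).re :=
  Complex.hasSum_re ((h ξ).mapL ((innerSL ℂ).flip ξ))

theorem exists_local_domination (h : IsNormalPLF M φ) {e : Op H}
    (he : IsProjIn (M : Set (Op H)) e) (h0 : e ≠ 0) :
    ∃ p, IsProjIn (M : Set (Op H)) p ∧ p ≠ 0 ∧ e * p = p ∧
      ∃ ζ, ∀ x ∈ M, (φ (p * (star x * x) * p)).re ≤ ‖x ζ‖ ^ 2 := by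
  obtain ⟨ξ, hξ⟩ : ∃ ξ, (φ e).re < (inner ℂ (e ξ) ξ).re := by
    obtain ⟨η, hη⟩ : ∃ η, e η ≠ 0 := by
      by_contra! hc
      exact h0 (ContinuousLinearMap.ext hc)
    obtain ⟨n, hn⟩ := exists_nat_gt ((φ e).re / ‖e η‖ ^ 2)
    refine ⟨((n + 1 : ℝ) : ℂ) • η, ?_⟩
    rw [he.inner_self, Complex.ofReal_re, map_smul, norm_smul, Complex.norm_real, mul_pow]
    have h1 : 0 < ‖e η‖ ^ 2 := by positivity
    rw [div_lt_iff₀ h1] at hn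
    refine hn.trans ?_
    gcongr
    rw [Real.norm_of_nonneg (by positivity)]
    nlinarith [(Nat.cast_nonneg n : (0 : ℝ) ≤ n)]
  obtain ⟨S, s, hS, ho, hs, hes, hsum, hmax⟩ := exists_maximal_orthogonal M e
    fun q => (inner ℂ (q ξ) ξ).re < (φ q).re
  have hp : IsProjIn (M : Set (Op H)) (e - s) := he.sub hs hes
  have hle : ∀ q, IsProjIn (M : Set (Op H)) q → (e - s) * q = q →
      (φ q).re ≤ (inner ℂ (q ξ) ξ).re := by
    intro q hq hpq
    by_contra! hlt
    have h1 : e * q = q := by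
      rw [← hpq, ← mul_assoc, mul_sub, he.2.2, hes]
    have h2 : s * q = 0 := by
      rw [← hpq, ← mul_assoc, mul_sub, hs.2.2, he.mul_eq_symm hs hes, sub_self, zero_mul]
    have h3 := hmax q hq h1 h2 hlt
    simp [h3, h.toIsPLF.map_zero] at hlt
  refine ⟨e - s, hp, fun hes0 => ?_, by rw [mul_sub, he.2.2, hes], (e - s) ξ,
    fun x hx => le_vector_of_le_on_projections h.toIsPLF hp hle hx⟩
  rw [sub_eq_zero] at hes0
  subst hes0
  have h1 := Complex.hasSum_re
    (h.normal S (fun i => (i : Op H)) e (fun i => (hS _ i.2).1) he ho hsum)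
  have h2 := hasSum_re_inner hsum ξ
  exact absurd hξ (not_lt.2 (hasSum_le (fun i => (hS _ i.2).2.2.2.le) h2 h1))

/-- Up to a projection of small `φ`-mass, a normal positive functional is dominated by a finite
sum of vector functionals. -/
theorem exists_domination (h : IsNormalPLF M φ) {ε : ℝ} (hε : 0 < ε) :
    ∃ p, IsProjIn (M : Set (Op H)) p ∧ (φ (1 - p)).re < ε ∧
      ∃ (n : ℕ) (ξ : Fin n → H), ∀ x ∈ M,
        (φ (p * (star x * x) * p)).re ≤ ∑ i, ‖x (ξ i)‖ ^ 2 := by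
  obtain ⟨S, s, hS, ho, hs, -, hsum, hmax⟩ := exists_maximal_orthogonal M 1
    fun p => ∃ ζ, ∀ x ∈ M, (φ (p * (star x * x) * p)).re ≤ ‖x ζ‖ ^ 2
  have hs1 : s = 1 := by
    by_contra hne
    obtain ⟨p, hp, hp0, hpe, hQ⟩ := exists_local_domination h hs.one_sub
      (fun h0 => hne (sub_eq_zero.1 h0).symm)
    refine hp0 (hmax p hp (one_mul p) ?_ hQ)
    rw [← hpe, ← mul_assoc, mul_sub, mul_one, hs.2.2, sub_self, zero_mul]
  subst hs1
  have h1 := Complex.hasSum_re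
    (h.normal S (fun i => (i : Op H)) 1 (fun i => (hS _ i.2).1) hs ho hsum)
  obtain ⟨F, hF⟩ := ((tendsto_order.1 h1).1 ((φ 1).re - ε) (by linarith)).exists
  have hpF (F : Finset S) : IsProjIn (M : Set (Op H)) (∑ i ∈ F, (i : Op H)) :=
    IsProjIn.finset_sum (fun i : S => (hS i i.2).1) ho F
  refine ⟨∑ i ∈ F, (i : Op H), hpF F, ?_, ?_⟩
  · rw [h.toIsPLF.map_sub (one_mem M) (hpF F).1, h.toIsPLF.map_sum _ _ fun i _ => (hS _ i.2).1.1,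
      Complex.sub_re, Complex.re_sum]
    linarith
  · clear hF
    classical
    induction F using Finset.induction_on with
    | empty => exact ⟨0, Fin.elim0, fun x _ => by simp [h.toIsPLF.map_zero]⟩
    | insert a F ha ih =>
      obtain ⟨n, ξ, hξ⟩ := ih
      obtain ⟨ζ, hζ⟩ := (hS a a.2).2.2.2
      refine ⟨n + 1, Fin.cons ((Real.sqrt 2 : ℂ) • ζ) fun i => (Real.sqrt 2 : ℂ) • ξ i,
        fun x hx => ?_⟩
      have ma := (hS a a.2).1
      have h2 := h.toIsPLF.re_add_le (mul_mem hx ma.1) (mul_mem hx (hpF F).1)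
      rw [Finset.sum_insert ha]
      simp only [star_mul, ma.2.1, (hpF F).2.1, ← mul_add, star_add] at h2
      have h3 := hζ x hx
      have h4 := hξ x hx
      simp only [Fin.sum_univ_succ, Fin.cons_zero, Fin.cons_succ, map_smul, norm_smul, mul_pow,
        Complex.norm_real, Real.norm_of_nonneg (Real.sqrt_nonneg 2), ← Finset.mul_sum,
        Real.sq_sqrt (zero_le_two : (0 : ℝ) ≤ 2)]
      simp only [mul_assoc] at h2 h3 h4 ⊢
      linarith

end Domination

/-! ### Density of star subalgebras -/

section Density

variable {A : StarSubalgebra ℂ (Op H)} {M : VonNeumannAlgebra H}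

theorem subset_bicommutant (hA : Set.centralizer (Set.centralizer (A : Set (Op H))) = M) {a : Op H}
    (ha : a ∈ A) : a ∈ M := by
  rw [← SetLike.mem_coe, ← hA]
  exact Set.subset_centralizer_centralizer ha

/-- A finite sum of vector functionals vanishing on `A` vanishes on the bicommutant of `A`. -/
theorem sum_inner_eq_zero_of_bicommutant {ι : Type*} [Fintype ι]
    (hA : Set.centralizer (Set.centralizer (A : Set (Op H))) = M) (ξ η : ι → H)
    (h : ∀ a ∈ A, ∑ i, inner ℂ (η i) (a (ξ i)) = 0) {x : Op H} (hx : x ∈ M) :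
    ∑ i, inner ℂ (η i) (x (ξ i)) = 0 := by
  classical
  let L := PiLp.continuousLinearEquiv 2 ℂ fun _ : ι => H
  let D (y : Op H) : (PiLp 2 fun _ : ι => H) →L[ℂ] PiLp 2 fun _ : ι => H :=
    L.symm.toContinuousLinearMap ∘L
    (ContinuousLinearMap.pi fun i => y ∘L ContinuousLinearMap.proj i) ∘L L.toContinuousLinearMap
  have D_apply (y : Op H) (k : PiLp 2 fun _ : ι => H) (i : ι) : D y k i = y (k i) := rfl
  have D_mul (y z : Op H) (k : PiLp 2 fun _ : ι => H) : D y (D z k) = D (y * z) k := rfl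
  have D_inner (y : Op H) (k l : PiLp 2 fun _ : ι => H) :
      inner ℂ (D y k) l = inner ℂ k (D (star y) l) := by
    simp only [PiLp.inner_apply, D_apply, ContinuousLinearMap.star_eq_adjoint,
      ContinuousLinearMap.adjoint_inner_right]
  let ev : Op H →ₗ[ℂ] PiLp 2 fun _ : ι => H :=
    { toFun := fun a => D a (WithLp.toLp 2 ξ)
      map_add' := fun a b => by ext i; simp [D_apply]
      map_smul' := fun c a => by ext i; simp [D_apply] }
  let U : Submodule ℂ (PiLp 2 fun _ : ι => H) :=
    (A.toSubalgebra.toSubmodule.map ev).topologicalClosure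
  have U_cl : IsClosed (U : Set (PiLp 2 fun _ : ι => H)) := Submodule.isClosed_topologicalClosure _
  have : CompleteSpace U := U_cl.completeSpace_coe
  have U_inv (a) (ha : a ∈ A) (k) (hk : k ∈ U) : D a k ∈ U := by
    have h1 : Set.MapsTo (D a) (A.toSubalgebra.toSubmodule.map ev : Set (PiLp 2 fun _ : ι => H))
        (A.toSubalgebra.toSubmodule.map ev : Set (PiLp 2 fun _ : ι => H)) := by
      rintro _ ⟨b, hb, rfl⟩
      exact ⟨a * b, mul_mem (S := StarSubalgebra ℂ (Op H)) ha hb, rfl⟩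
    exact h1.closure (D a).continuous hk
  let P : (PiLp 2 fun _ : ι => H) →L[ℂ] PiLp 2 fun _ : ι => H := U.starProjection
  have P_mem (k : PiLp 2 fun _ : ι => H) : P k ∈ U := U.starProjection_apply_mem k
  have P_comm (a) (ha : a ∈ A) (k : PiLp 2 fun _ : ι => H) : P (D a k) = D a (P k) := by
    refine (Submodule.eq_starProjection_of_mem_of_inner_eq_zero (U_inv a ha _ (P_mem k))
      fun w hw => ?_)
    rw [← map_sub, D_inner]
    exact U.starProjection_inner_eq_zero k _ (U_inv _ (star_mem ha) w hw)
  let E (i j : ι) : Op H := ContinuousLinearMap.proj i ∘L L.toContinuousLinearMap ∘L P ∘L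
    L.symm.toContinuousLinearMap ∘L ContinuousLinearMap.single ℂ (fun _ : ι => H) j
  have E_apply (i j : ι) (ζ : H) : E i j ζ = P (PiLp.single 2 j ζ) i := rfl
  have D_single (y : Op H) (j : ι) (ζ : H) : D y (PiLp.single 2 j ζ) = PiLp.single 2 j (y ζ) := by
    ext i
    rw [D_apply]
    by_cases hij : i = j
    · subst hij; simp
    · simp [hij]
  have E_mem (i j : ι) : E i j ∈ Set.centralizer (A : Set (Op H)) := by
    intro a ha
    ext ζ
    rw [mul_apply_eq_comp, mul_apply_eq_comp, E_apply, E_apply, ← D_single, P_comm a ha, D_apply]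
  have E_comm (i j : ι) : E i j * x = x * E i j := by
    have hx' : x ∈ Set.centralizer (Set.centralizer (A : Set (Op H))) := by rw [hA]; exact hx
    exact hx' _ (E_mem i j)
  have P_x (k : PiLp 2 fun _ : ι => H) : P (D x k) = D x (P k) := by
    have key (j : ι) (ζ : H) : P (D x (PiLp.single 2 j ζ)) = D x (P (PiLp.single 2 j ζ)) := by
      ext i
      rw [D_single, D_apply, ← E_apply, ← E_apply]
      exact congr($(E_comm i j) ζ)
    have hk : k = ∑ j, PiLp.single 2 j (k j) := by
      ext i
      simp
    rw [hk]
    simp only [map_sum, key]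
  have xi_mem : WithLp.toLp 2 ξ ∈ U :=
    Submodule.le_topologicalClosure _ ⟨1, one_mem A, rfl⟩
  have h1 : D x (WithLp.toLp 2 ξ) ∈ U := by
    have := P_x (WithLp.toLp 2 ξ)
    rw [Submodule.starProjection_eq_self_iff.2 xi_mem] at this
    rw [← this]
    exact P_mem _
  have h2 : ∀ k ∈ U, inner ℂ (WithLp.toLp 2 η : PiLp 2 fun _ : ι => H) k = 0 := by
    have hcl : IsClosed {k : PiLp 2 fun _ : ι => H |
        inner ℂ (WithLp.toLp 2 η : PiLp 2 fun _ : ι => H) k = 0} :=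
      isClosed_eq (by fun_prop) continuous_const
    refine fun k hk => hcl.closure_subset_iff.2 ?_ hk
    rintro _ ⟨a, ha, rfl⟩
    exact h a ha
  exact h2 _ h1

/-- Self-adjoint elements of the bicommutant are strong limits of self-adjoint elements. -/
theorem exists_selfAdjoint_approx {ι : Type*} [Fintype ι]
    (hA : Set.centralizer (Set.centralizer (A : Set (Op H))) = M) {x : Op H} (hx : x ∈ M)
    (hsa : star x = x) (ξ : ι → H) {ε : ℝ} (hε : 0 < ε) :
    ∃ a ∈ A, star a = a ∧ ∀ i, ‖(x - a) (ξ i)‖ < ε := by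
  classical
  let ev : Op H →ₗ[ℝ] (ι → H) :=
    { toFun := fun a i => a (ξ i)
      map_add' := fun a b => rfl
      map_smul' := fun c a => rfl }
  let V : Submodule ℝ (ι → H) := (A.toSubalgebra.toSubmodule.restrictScalars ℝ ⊓
    (selfAdjoint.submodule ℝ (Op H))).map ev
  have hmem : ev x ∈ closure (V : Set (ι → H)) := by
    by_contra hnot
    obtain ⟨f, u, hf, hu⟩ := RCLike.geometric_hahn_banach_closed_point (𝕜 := ℂ)
      V.convex.closure isClosed_closure hnot
    have hu0 : 0 < u := by simpa using hf 0 (subset_closure V.zero_mem)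
    have hV : ∀ a ∈ A, star a = a → (f (ev a)).re = 0 := by
      intro a ha ha'
      by_contra hne
      have h1 := hf (ev (((u / (f (ev a)).re : ℝ)) • a)) (subset_closure
        ⟨_, (Submodule.smul_mem _ _ ⟨ha, ha'⟩ : _ ∈ A.toSubalgebra.toSubmodule.restrictScalars ℝ ⊓
          (selfAdjoint.submodule ℝ (Op H))), rfl⟩)
      rw [map_smul, ← Complex.coe_smul, map_smul] at h1
      simp [div_mul_cancel₀ _ hne] at h1
    let η : ι → H := fun i =>
      (InnerProductSpace.toDual ℂ H).symm (f ∘L ContinuousLinearMap.single ℂ (fun _ : ι => H) i)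
    have fη (y : Op H) : f (ev y) = ∑ i, inner ℂ (η i) (y (ξ i)) := by
      conv_lhs => rw [← Finset.univ_sum_single (ev y), map_sum]
      refine Finset.sum_congr rfl fun i _ => ?_
      rw [InnerProductSpace.toDual_symm_apply]
      rfl
    have G_sa (y : Op H) (hy : star y = y) :
        ∑ i : ι ⊕ ι, inner ℂ (Sum.elim η ξ i) (y (Sum.elim ξ η i)) = 2 * (f (ev y)).re := by
      have h1 : ∑ i, inner ℂ (ξ i) (y (η i)) = star (f (ev y)) := by
        rw [fη, star_sum]
        refine Finset.sum_congr rfl fun i _ => ?_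
        rw [← starRingEnd_apply, inner_conj_symm]
        conv_rhs => rw [← hy, ContinuousLinearMap.star_eq_adjoint,
          ContinuousLinearMap.adjoint_inner_left]
      simp only [Fintype.sum_sum_type, Sum.elim_inl, Sum.elim_inr, ← fη, h1]
      apply Complex.ext <;> simp; ring
    have G_add (c d : ℂ) (y z : Op H) :
        ∑ i : ι ⊕ ι, inner ℂ (Sum.elim η ξ i) ((c • y + d • z) (Sum.elim ξ η i)) =
          c * ∑ i : ι ⊕ ι, inner ℂ (Sum.elim η ξ i) (y (Sum.elim ξ η i)) +
          d * ∑ i : ι ⊕ ι, inner ℂ (Sum.elim η ξ i) (z (Sum.elim ξ η i)) := by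
      rw [Finset.mul_sum, Finset.mul_sum, ← Finset.sum_add_distrib]
      refine Finset.sum_congr rfl fun i _ => ?_
      simp
    have h1 := sum_inner_eq_zero_of_bicommutant hA (Sum.elim ξ η) (Sum.elim η ξ) (fun a ha => by
      have hb : star (a + star a) = a + star a := by simp [add_comm]
      have hc : star (Complex.I • (a - star a)) = Complex.I • (a - star a) := by
        simp [smul_sub, neg_add_eq_sub]
      have e : a = (1 / 2 : ℂ) • (a + star a) + (-Complex.I / 2) • (Complex.I • (a - star a)) := by
        rw [smul_smul, show -Complex.I / 2 * Complex.I = 1 / 2 by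
          rw [div_mul_eq_mul_div, neg_mul, Complex.I_mul_I, neg_neg], smul_add, smul_sub]
        module
      rw [e, G_add, G_sa _ hb, G_sa _ hc, hV _ (add_mem ha (star_mem ha)) hb,
        hV _ (A.smul_mem (sub_mem ha (star_mem ha)) _) hc]
      simp) hx
    rw [G_sa x hsa] at h1
    have h2 : (f (ev x)).re = 0 := by simpa using congr(($h1).re)
    exact absurd hu (by rw [RCLike.re_eq_complex_re, h2]; exact not_lt.2 hu0.le)
  obtain ⟨_, ⟨a, ⟨ha, ha'⟩, rfl⟩, h⟩ := Metric.mem_closure_iff.1 hmem ε hε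
  refine ⟨a, ha, ha', fun i => ?_⟩
  rw [dist_eq_norm] at h
  exact (norm_le_pi_norm (ev x - ev a) i).trans_lt h

end Density

/-! ### Bounded approximation in the seminorms of a normal functional -/

section Smoothing

variable {A : StarSubalgebra ℂ (Op H)} {M : VonNeumannAlgebra H} {φ : Op H → ℂ}

theorem exists_resolvent {x : Op H} (hsa : star x = x) {t : ℝ} (ht : 0 < t) :
    ∃ r : Op H, r * (x + (t * Complex.I : ℂ) • 1) = 1 ∧ (x + (t * Complex.I : ℂ) • 1) * r = 1 ∧
      ‖r‖ ≤ t⁻¹ ∧ ∀ B : StarSubalgebra ℂ (Op H), IsClosed (B : Set (Op H)) → x ∈ B → r ∈ B := by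
  set y : Op H := x + (t * Complex.I : ℂ) • 1 with hy
  have lower (ξ : H) : ‖ξ‖ ^ 2 * t ≤ ‖inner ℂ (y ξ) ξ‖ := by
    have h1 : (inner ℂ (x ξ) ξ).im = 0 := by
      have h2 : inner ℂ (x ξ) ξ = star (inner ℂ (x ξ) ξ) := by
        rw [← starRingEnd_apply, inner_conj_symm]
        conv_lhs => rw [← hsa, ContinuousLinearMap.star_eq_adjoint,
          ContinuousLinearMap.adjoint_inner_left]
      have h3 := congr(($h2).im)
      simp only [Complex.star_def, Complex.conj_im] at h3
      linarith
    have h2 : (inner ℂ (y ξ) ξ).im = -(t * ‖ξ‖ ^ 2) := by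
      simp only [hy, add_apply, smul_apply, one_apply_eq_self, inner_add_left, inner_smul_left,
        inner_self_eq_norm_sq_to_K, Complex.add_im, h1]
      have h2 : ((‖ξ‖ : ℂ) ^ 2).re = ‖ξ‖ ^ 2 := by norm_cast
      simp [h2]
    have h3 := Complex.abs_im_le_norm (inner ℂ (y ξ) ξ)
    rw [h2, abs_neg, abs_of_nonneg (by positivity)] at h3
    linarith
  have hu : IsUnit y := y.isUnit_of_forall_le_norm_inner_map (c := ⟨t, ht.le⟩) ht lower
  refine ⟨(↑hu.unit⁻¹ : Op H), hu.val_inv_mul, hu.mul_val_inv, ?_, fun B hB hxB => ?_⟩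
  · refine ContinuousLinearMap.opNorm_le_bound _ (by positivity) fun ξ => ?_
    set ζ := (↑hu.unit⁻¹ : Op H) ξ with hζ
    have h1 : y ζ = ξ := congr($(hu.mul_val_inv) ξ)
    have h2 := (lower ζ).trans (norm_inner_le_norm (y ζ) ζ)
    rw [h1] at h2
    rw [inv_mul_eq_div, le_div_iff₀ ht]
    rcases (norm_nonneg ζ).eq_or_lt with h0 | h0
    · rw [← h0, zero_mul]; positivity
    · nlinarith
  · have hyB : y ∈ B := add_mem hxB (B.smul_mem (one_mem B) _)
    have : IsClosed (B : Set (Op H)) := hB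
    obtain ⟨w, hw⟩ := (StarSubalgebra.coe_isUnit (S := B) (a := ⟨y, hyB⟩)).1 hu
    have h1 : ((↑w⁻¹ : B) : Op H) * y = 1 := by
      have := congr(((↑) : B → Op H) $(w.inv_mul))
      rwa [hw] at this
    have h2 : (↑hu.unit⁻¹ : Op H) = ((↑w⁻¹ : B) : Op H) := by
      rw [← one_mul (↑hu.unit⁻¹ : Op H), ← h1, mul_assoc, hu.mul_val_inv, mul_one]
    rw [h2]
    exact (↑w⁻¹ : B).2

/-- The bounded smooth cut-off `t² x (x² + t²)⁻¹` of a self-adjoint operator, with the resolvent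
entering its definition. -/
theorem exists_cutoff {x : Op H} (hsa : star x = x) {t : ℝ} (ht : 0 < t) :
    ∃ r g : Op H, r * (x + (t * Complex.I : ℂ) • 1) = 1 ∧ (x + (t * Complex.I : ℂ) • 1) * r = 1 ∧
      ‖r‖ ≤ t⁻¹ ∧ g = ((t ^ 2 / 2 : ℝ) : ℂ) • (r + star r) ∧ ‖x - g‖ ≤ ‖x‖ ^ 2 / t ∧ ‖g‖ ≤ t ∧
      ∀ B : StarSubalgebra ℂ (Op H), IsClosed (B : Set (Op H)) → x ∈ B → r ∈ B ∧ g ∈ B := by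
  obtain ⟨r, hr1, hr2, hr3, hr4⟩ := exists_resolvent hsa ht
  have hI : Complex.I * Complex.I = -1 := Complex.I_mul_I
  have e1 : x - ((t * Complex.I : ℂ) • 1 + ((t ^ 2 : ℝ) : ℂ) • r) = x * x * r := by
    have h1 : x * r = 1 - (t * Complex.I : ℂ) • r := by
      rw [← hr2, add_mul, smul_mul_assoc, one_mul]
      abel
    rw [mul_assoc, h1, mul_sub, mul_smul_comm, h1, smul_sub, smul_smul]
    rw [show (t * Complex.I : ℂ) * (t * Complex.I) = -((t ^ 2 : ℝ) : ℂ) by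
      push_cast
      linear_combination (t : ℂ) ^ 2 * hI]
    rw [mul_one]
    module
  have e2 := congr(star $e1)
  simp only [star_sub, star_add, star_smul, star_mul, hsa, star_one, Complex.star_def,
    Complex.conj_ofReal, Complex.conj_I] at e2
  have e3 : x - ((t ^ 2 / 2 : ℝ) : ℂ) • (r + star r) =
      (1 / 2 : ℂ) • (x * x * r + star r * (x * x)) := by
    rw [← e1, ← e2]
    push_cast
    module
  have hsr : ‖star r‖ ≤ t⁻¹ := by rwa [norm_star]
  refine ⟨r, _, hr1, hr2, hr3, rfl, ?_, ?_, fun B hB hx =>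
    ⟨hr4 B hB hx, B.smul_mem (add_mem (hr4 B hB hx) (star_mem (hr4 B hB hx))) _⟩⟩
  · rw [e3, norm_smul]
    have h1 : ‖x * x * r‖ ≤ ‖x‖ * ‖x‖ * t⁻¹ :=
      (norm_mul_le _ _).trans (mul_le_mul (norm_mul_le _ _) hr3 (norm_nonneg _) (by positivity))
    have h2 : ‖star r * (x * x)‖ ≤ t⁻¹ * (‖x‖ * ‖x‖) :=
      (norm_mul_le _ _).trans (mul_le_mul hsr (norm_mul_le _ _) (norm_nonneg _) (by positivity))
    have h3 := norm_add_le (x * x * r) (star r * (x * x))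
    rw [show ‖(1 / 2 : ℂ)‖ = 1 / 2 by norm_num]
    have h4 : t⁻¹ * (‖x‖ * ‖x‖) = ‖x‖ ^ 2 / t := by ring
    have h5 : ‖x‖ * ‖x‖ * t⁻¹ = ‖x‖ ^ 2 / t := by ring
    linarith
  · rw [norm_smul, Complex.norm_real, Real.norm_of_nonneg (by positivity)]
    calc t ^ 2 / 2 * ‖r + star r‖ ≤ t ^ 2 / 2 * (t⁻¹ + t⁻¹) := by
          gcongr
          exact (norm_add_le _ _).trans (add_le_add hr3 hsr)
      _ = t := by field_simp; norm_num

theorem exists_approx_selfAdjoint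
    (hA : Set.centralizer (Set.centralizer (A : Set (Op H))) = M) (h : IsNormalPLF M φ)
    {v : Op H} (hv : v ∈ M) (hsa : star v = v) {ε : ℝ} (hε : 0 < ε) :
    ∃ b ∈ A.topologicalClosure, star b = b ∧ (φ (star (v - b) * (v - b))).re < ε := by
  set m := (φ 1).re with hm
  have m0 : 0 ≤ m := h.toIsPLF.one_re_nonneg
  have hAM : (A.topologicalClosure : Set (Op H)) ⊆ M :=
    (vn_isClosed M).closure_subset_iff.2 fun a ha => subset_bicommutant hA ha
  obtain ⟨t, ht, ht1⟩ : ∃ t : ℝ, 0 < t ∧ 2 * ((‖v‖ ^ 2 / t) ^ 2 * m) < ε / 2 := by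
    have h1 : Filter.Tendsto (fun t : ℝ => 2 * ((‖v‖ ^ 2 / t) ^ 2 * m)) Filter.atTop (nhds 0) := by
      have := (((Filter.tendsto_id (α := ℝ)).const_div_atTop (‖v‖ ^ 2)).pow 2).mul_const m
      simpa using this.const_mul 2
    obtain ⟨t, h2, h3⟩ := ((h1.eventually (gt_mem_nhds (half_pos hε))).and
      (Filter.eventually_gt_atTop 0)).exists
    exact ⟨t, h3, h2⟩
  obtain ⟨p, hp, hpε, n, ξ, hdom⟩ := exists_domination h (ε := ε / (64 * t ^ 2)) (by positivity)
  obtain ⟨r, g, hr1, hr2, hr3, hg, hvg, hgt, hB⟩ := exists_cutoff hsa ht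
  obtain ⟨hrM, hgM⟩ := hB M.toStarSubalgebra (vn_isClosed M) hv
  obtain ⟨δ, hδ, hδε⟩ : ∃ δ : ℝ, 0 < δ ∧ n * (t * δ) ^ 2 < ε / 16 := by
    have h1 : Filter.Tendsto (fun δ : ℝ => n * (t * δ) ^ 2) (nhdsWithin 0 (Set.Ioi 0))
        (nhds 0) := by
      have : Continuous fun δ : ℝ => n * (t * δ) ^ 2 := by fun_prop
      simpa using (this.tendsto 0).mono_left nhdsWithin_le_nhds
    obtain ⟨δ, h2, h3⟩ := ((h1.eventually (gt_mem_nhds (by positivity : (0 : ℝ) < ε / 16))).and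
      self_mem_nhdsWithin).exists
    exact ⟨δ, h3, h2⟩
  obtain ⟨a, ha, ha', hav⟩ := exists_selfAdjoint_approx hA hv hsa
    (Sum.elim (fun i => r (ξ i)) fun i => star r (ξ i)) hδ
  obtain ⟨s, b, hs1, hs2, hs3, hb, -, hbt, hB'⟩ := exists_cutoff ha' ht
  have hbA := (hB' A.topologicalClosure A.isClosed_topologicalClosure
    (A.le_topologicalClosure ha)).2
  have hbM : b ∈ M := hAM hbA
  have hss : ‖star s‖ ≤ t⁻¹ := by rwa [norm_star]
  have hbs : star b = b := by
    rw [hb, star_smul, star_add, star_star, Complex.star_def, Complex.conj_ofReal, add_comm]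
  refine ⟨b, hbA, hbs, ?_⟩
  have d1 : r - s = s * (a - v) * r := by
    have : a - v = (a + (t * Complex.I : ℂ) • 1) - (v + (t * Complex.I : ℂ) • 1) := by abel
    rw [this, mul_sub, sub_mul, hs1, mul_assoc, hr2, one_mul, mul_one]
  have d2 : star r - star s = star s * (a - v) * star r := by
    have e1 := congr(star $hr1)
    have e2 := congr(star $hs2)
    simp only [star_add, star_mul, star_one, star_smul, hsa, ha'] at e1 e2
    have : a - v = (a + (star Complex.I * star (t : ℂ)) • 1) -
        (v + (star Complex.I * star (t : ℂ)) • 1) := by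
      abel
    rw [this, mul_sub, sub_mul, e2, mul_assoc, e1, one_mul, mul_one]
  have d3 : g - b = ((t ^ 2 / 2 : ℝ) : ℂ) • (s * (a - v) * r + star s * (a - v) * star r) := by
    rw [← d1, ← d2, hg, hb]
    module
  have d4 (i : Fin n) : ‖(g - b) (ξ i)‖ ≤ t * δ := by
    have f1 : ‖(s * (a - v) * r) (ξ i)‖ ≤ t⁻¹ * δ := by
      refine (s.le_of_opNorm_le hs3 _).trans ?_
      gcongr
      have := hav (.inl i)
      rw [← norm_neg, ← neg_apply, neg_sub] at this
      exact this.le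
    have f2 : ‖(star s * (a - v) * star r) (ξ i)‖ ≤ t⁻¹ * δ := by
      refine ((star s).le_of_opNorm_le hss _).trans ?_
      gcongr
      have := hav (.inr i)
      rw [← norm_neg, ← neg_apply, neg_sub] at this
      exact this.le
    rw [d3, smul_apply, add_apply, norm_smul, Complex.norm_real,
      Real.norm_of_nonneg (by positivity)]
    calc _ ≤ t ^ 2 / 2 * (t⁻¹ * δ + t⁻¹ * δ) := by
          gcongr
          exact (norm_add_le _ _).trans (add_le_add f1 f2)
      _ = t * δ := by field_simp; ring
  have hd : g - b ∈ M := sub_mem hgM hbM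
  have b1 : (φ (star (v - g) * (v - g))).re ≤ (‖v‖ ^ 2 / t) ^ 2 * m := by
    refine (h.toIsPLF.star_mul_self_le (sub_mem hv hgM)).trans ?_
    gcongr
  have b2 : (φ (p * (star (g - b) * (g - b)) * p)).re ≤ n * (t * δ) ^ 2 := by
    refine (hdom _ hd).trans ?_
    calc _ ≤ ∑ _i : Fin n, (t * δ) ^ 2 := Finset.sum_le_sum fun i _ => by gcongr; exact d4 i
      _ = _ := by simp
  have b3 : (φ ((1 - p) * (star (g - b) * (g - b)) * (1 - p))).re ≤
      (2 * t) ^ 2 * (φ (1 - p)).re := by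
    have hq := hp.one_sub
    have h1 : (1 - p) * (star (g - b) * (g - b)) * (1 - p) ≤ ((‖g - b‖ ^ 2 : ℝ) : ℂ) • (1 - p) := by
      have := star_left_conjugate_le_conjugate
        (CStarAlgebra.star_mul_le_algebraMap_norm_sq (a := g - b)) (1 - p)
      rw [Algebra.algebraMap_eq_smul_one, ← Complex.coe_smul, hq.2.1] at this
      simpa only [mul_smul_comm, smul_mul_assoc, mul_one, hq.2.2] using this
    have h2 := h.toIsPLF.re_le (mul_mem (mul_mem hq.1 (mul_mem (star_mem hd) hd)) hq.1)
      (vn_smul_mem _ hq.1) h1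
    rw [h.map_smul _ _ hq.1, Complex.re_ofReal_mul] at h2
    refine h2.trans ?_
    have h3 : 0 ≤ (φ (1 - p)).re := (Complex.le_def.1 (h.toIsPLF.nonneg hq.1 hq.nonneg)).1
    gcongr
    refine (norm_sub_le _ _).trans ?_
    linarith
  have b4 := h.toIsPLF.re_add_le (mul_mem hd hp.1) (mul_mem hd hp.one_sub.1)
  rw [← mul_add, add_sub_cancel, mul_one] at b4
  simp only [star_mul, hp.2.1, hp.one_sub.2.1, mul_assoc] at b2 b3 b4
  have b5 := h.toIsPLF.re_add_le (sub_mem hv hgM) hd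
  rw [sub_add_sub_cancel] at b5
  have b6 : (2 * t) ^ 2 * (φ (1 - p)).re ≤ ε / 16 := by
    calc _ ≤ (2 * t) ^ 2 * (ε / (64 * t ^ 2)) := by gcongr
      _ = ε / 16 := by field_simp; norm_num
  linarith

/-- A star subalgebra is dense in its bicommutant for the strong-* seminorm of a normal
functional. -/
theorem exists_approx (hA : Set.centralizer (Set.centralizer (A : Set (Op H))) = M)
    (h : IsNormalPLF M φ) {v : Op H} (hv : v ∈ M) {ε : ℝ} (hε : 0 < ε) :
    ∃ a ∈ A, (φ (star (v - a) * (v - a))).re < ε ∧ (φ ((v - a) * star (v - a))).re < ε := by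
  have hAM : (A.topologicalClosure : Set (Op H)) ⊆ M :=
    (vn_isClosed M).closure_subset_iff.2 fun a ha => subset_bicommutant hA ha
  set v₁ := v + star v with hv₁
  set v₂ := Complex.I • (v - star v) with hv₂
  have m₁ : v₁ ∈ M := add_mem hv (star_mem hv)
  have m₂ : v₂ ∈ M := vn_smul_mem _ (sub_mem hv (star_mem hv))
  have s₁ : star v₁ = v₁ := by simp [hv₁, add_comm]
  have s₂ : star v₂ = v₂ := by simp [hv₂, smul_sub, neg_add_eq_sub]
  have ev : v = (1 / 2 : ℂ) • v₁ + (-Complex.I / 2) • v₂ := by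
    rw [hv₂, smul_smul, show -Complex.I / 2 * Complex.I = 1 / 2 by
      rw [div_mul_eq_mul_div, neg_mul, Complex.I_mul_I, neg_neg], hv₁]
    module
  obtain ⟨b₁, hb₁, sb₁, e₁⟩ := exists_approx_selfAdjoint hA h m₁ s₁ (half_pos (half_pos hε))
  obtain ⟨b₂, hb₂, sb₂, e₂⟩ := exists_approx_selfAdjoint hA h m₂ s₂ (half_pos (half_pos hε))
  set b := (1 / 2 : ℂ) • b₁ + (-Complex.I / 2) • b₂ with hb
  have hbA : b ∈ A.topologicalClosure := add_mem (SMulMemClass.smul_mem _ hb₁)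
    (SMulMemClass.smul_mem _ hb₂)
  have hc₁ := sub_mem m₁ (hAM hb₁)
  have hc₂ := sub_mem m₂ (hAM hb₂)
  have key (α : ℂ) (hα : ‖α‖ = 1 / 2) :
      (φ (star ((1 / 2 : ℂ) • (v₁ - b₁) + α • (v₂ - b₂)) *
        ((1 / 2 : ℂ) • (v₁ - b₁) + α • (v₂ - b₂)))).re ≤ ε / 4 := by
    have scale {c : Op H} (hc : c ∈ M) {β : ℂ} (hβ : ‖β‖ = 1 / 2) :
        (φ (star (β • c) * (β • c))).re = (φ (star c * c)).re / 4 := by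
      have h1 : star β * β = ((1 / 4 : ℝ) : ℂ) := by
        rw [mul_comm, Complex.star_def, Complex.mul_conj, Complex.normSq_eq_norm_sq, hβ]
        norm_num
      rw [star_smul, smul_mul_smul_comm, h1, h.map_smul _ _ (mul_mem (star_mem hc) hc),
        Complex.re_ofReal_mul]
      ring
    have := h.toIsPLF.re_add_le (vn_smul_mem (1 / 2 : ℂ) hc₁) (vn_smul_mem α hc₂)
    rw [scale hc₁ (by norm_num), scale hc₂ hα] at this
    linarith
  have hvb : v - b = (1 / 2 : ℂ) • (v₁ - b₁) + (-Complex.I / 2) • (v₂ - b₂) := by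
    rw [hb]
    nth_rw 1 [ev]
    module
  have hvb' : star (v - b) = (1 / 2 : ℂ) • (v₁ - b₁) + (Complex.I / 2) • (v₂ - b₂) := by
    rw [hvb]
    simp [s₁, s₂, sb₁, sb₂]
  have k₁ := key (-Complex.I / 2) (by simp)
  have k₂ := key (Complex.I / 2) (by simp)
  rw [← hvb] at k₁
  rw [← hvb', star_star] at k₂
  obtain ⟨δ, hδ, hδε⟩ : ∃ δ : ℝ, 0 < δ ∧ δ ^ 2 * (φ 1).re < ε / 4 := by
    have h1 : Filter.Tendsto (fun δ : ℝ => δ ^ 2 * (φ 1).re) (nhdsWithin 0 (Set.Ioi 0))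
        (nhds 0) := by
      have : Continuous fun δ : ℝ => δ ^ 2 * (φ 1).re := by fun_prop
      simpa using (this.tendsto 0).mono_left nhdsWithin_le_nhds
    obtain ⟨δ, h2, h3⟩ := ((h1.eventually (gt_mem_nhds (by positivity : (0 : ℝ) < ε / 4))).and
      self_mem_nhdsWithin).exists
    exact ⟨δ, h3, h2⟩
  obtain ⟨a, ha, hab⟩ := Metric.mem_closure_iff.1 hbA δ hδ
  rw [dist_eq_norm] at hab
  have m0 := h.toIsPLF.one_re_nonneg
  have haM := subset_bicommutant hA ha
  have hd : b - a ∈ M := sub_mem (hAM hbA) haM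
  have hvbM : v - b ∈ M := sub_mem hv (hAM hbA)
  have hn : ‖b - a‖ ^ 2 * (φ 1).re ≤ δ ^ 2 * (φ 1).re := by gcongr
  have hn₁ := (h.toIsPLF.star_mul_self_le hd).trans hn
  have hn₂ := h.toIsPLF.star_mul_self_le (star_mem hd)
  rw [norm_star] at hn₂
  replace hn₂ := hn₂.trans hn
  have l₁ := h.toIsPLF.re_add_le hvbM hd
  have l₂ := h.toIsPLF.re_add_le (star_mem hvbM) (star_mem hd)
  rw [sub_add_sub_cancel] at l₁
  rw [← star_add, sub_add_sub_cancel] at l₂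
  simp only [star_star] at l₂ hn₂
  exact ⟨a, ha, by linarith, by linarith⟩

end Smoothing

/-! ### Supports, centralizers and polar decomposition -/

section Polar

variable {M : VonNeumannAlgebra H} {φ : Op H → ℂ}

/-- A nonzero positive operator is invertible on some nonzero spectral projection `e`, with
`y = x^{-1/2} e` obtained by functional calculus. -/
theorem exists_cut_inverse {x : Op H} (hx : x ∈ M) (h0 : 0 ≤ x) (hne : x ≠ 0) :
    ∃ e y, IsProjIn (M : Set (Op H)) e ∧ e ≠ 0 ∧ y ∈ M ∧ star y = y ∧ y * x * y = e ∧
      ∀ z, Commute x z → Commute y z := by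
  have hsa : IsSelfAdjoint x := .of_nonneg h0
  have hn : 0 < ‖x‖ := norm_pos_iff.2 hne
  set c := ‖x‖ / 2 with hc
  have c0 : 0 < c := half_pos hn
  have hm0 (t : ℝ) : 0 < max t c := c0.trans_le (le_max_right _ _)
  set a : Op H := cfc (fun t : ℝ => max (t - c) 0) x with ha
  set g : Op H := cfc (fun t : ℝ => (√(max t c))⁻¹) x with hg
  set k : Op H := cfc (fun t : ℝ => 1 - t * (max t c)⁻¹) x with hk
  have gcont : Continuous fun t : ℝ => (√(max t c))⁻¹ :=
    (by fun_prop : Continuous fun t : ℝ => √(max t c)).inv₀ fun t => (Real.sqrt_pos.2 (hm0 t)).ne'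
  have kcont : Continuous fun t : ℝ => 1 - t * (max t c)⁻¹ :=
    continuous_const.sub (continuous_id.mul
      ((by fun_prop : Continuous fun t : ℝ => max t c).inv₀ fun t => (hm0 t).ne'))
  have acont : Continuous fun t : ℝ => max (t - c) 0 := by fun_prop
  have gs : star g = g := (cfc_predicate (fun t : ℝ => (√(max t c))⁻¹) x : IsSelfAdjoint _)
  have as : star a = a := (cfc_predicate (fun t : ℝ => max (t - c) 0) x : IsSelfAdjoint _)
  have ak : a * k = 0 := by
    rw [ha, hk, ← cfc_mul _ _ x acont.continuousOn kcont.continuousOn, ← cfc_zero ℝ x]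
    refine cfc_congr fun t _ => ?_
    rcases le_total t c with h | h
    · simp [h]
    · have : t ≠ 0 := (c0.trans_le h).ne'
      simp [max_eq_left h, this]
  have gxg : g * x * g = 1 - k := by
    have h1 : g * x = cfc (fun t : ℝ => (√(max t c))⁻¹ * t) x := by
      rw [cfc_mul (fun t : ℝ => (√(max t c))⁻¹) (fun t : ℝ => t) x gcont.continuousOn
        continuous_id.continuousOn, cfc_id' ℝ x]
    have h2 : k = 1 - cfc (fun t : ℝ => t * (max t c)⁻¹) x := by
      rw [hk, cfc_sub (fun _ : ℝ => (1 : ℝ)) (fun t : ℝ => t * (max t c)⁻¹) x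
        continuous_const.continuousOn (continuous_id.mul
          ((by fun_prop : Continuous fun t : ℝ => max t c).inv₀
          fun t => (hm0 t).ne')).continuousOn, cfc_const_one ℝ x]
    rw [h1, h2, sub_sub_cancel, hg, ← cfc_mul (fun t : ℝ => (√(max t c))⁻¹ * t) _ x
      (gcont.mul continuous_id).continuousOn gcont.continuousOn]
    refine cfc_congr fun t _ => ?_
    have := Real.mul_self_sqrt (hm0 t).le
    change (√(max t c))⁻¹ * t * (√(max t c))⁻¹ = t * (max t c)⁻¹
    conv_rhs => rw [← this]
    rw [mul_inv]
    ring
  obtain ⟨e, he, ea, ae, ez, ec⟩ := exists_range_projection (vn_cfc_mem hx _ : a ∈ M) as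
  have hcomm {z : Op H} (hz : Commute x z) : Commute e z :=
    ec z (hz.cfc_real _)
  have eg : Commute e g := ec g ((cfc_commute_cfc _ _ _))
  have ek : e * k = 0 := ez k ak
  have nontriv : Nontrivial (Op H) := ⟨x, 0, hne⟩
  refine ⟨e, g * e, he, fun e0 => ?_, mul_mem (vn_cfc_mem hx _) he.1, ?_, ?_, fun z hz => ?_⟩
  · have h1 : ‖x‖ ∈ spectrum ℝ x := CStarAlgebra.norm_mem_spectrum_of_nonneg h0
    have h2 := norm_apply_le_norm_cfc (fun t : ℝ => max (t - c) 0) x h1 acont.continuousOn hsa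
    rw [← ea, e0, zero_mul, norm_zero, norm_le_zero_iff] at h2
    have h3 : ‖x‖ - c ≤ 0 := by
      have := le_max_left (‖x‖ - c) 0
      rwa [h2] at this
    linarith
  · rw [star_mul, he.2.1, gs, eg.eq]
  · have h1 : g * e * x * (g * e) = e * (g * x * g) * e := by
      rw [← eg.eq]
      simp only [mul_assoc]
      rw [eg.eq]
    rw [h1, gxg, mul_sub, mul_one, ek, sub_zero, he.2.2]
  · exact (hz.cfc_real _).mul_left (hcomm hz)

theorem IsPLF.mul_eq_zero_of_null (h : IsPLF M φ) {r y : Op H}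
    (hr : IsProjIn (M : Set (Op H)) r) (h0 : φ r = 0) (hy : y ∈ M) :
    φ (r * y) = 0 ∧ φ (y * r) = 0 := by
  have h1 := h.cauchy_schwarz hy hr.1
  have h2 := h.cauchy_schwarz hr.1 hy
  simp only [hr.2.1, hr.2.2, h0, Complex.zero_re, zero_mul, mul_zero] at h1 h2
  exact ⟨norm_eq_zero.1 (pow_eq_zero_iff two_ne_zero |>.1 (le_antisymm h1 (by positivity))),
    norm_eq_zero.1 (pow_eq_zero_iff two_ne_zero |>.1 (le_antisymm h2 (by positivity)))⟩

theorem exists_isSupportProjOf (h : IsNormalPLF M φ) : ∃ p, IsSupportProjOf M φ p := by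
  obtain ⟨S, s, hS, ho, hs, -, hsum, hmax⟩ := exists_maximal_orthogonal M 1 fun r => φ r = 0
  have s0 : φ s = 0 := by
    have h1 := h.normal S (fun i => (i : Op H)) s (fun i => (hS _ i.2).1) hs ho hsum
    have h2 : (fun i : S => φ (i : Op H)) = fun _ => 0 := funext fun i => (hS _ i.2).2.2.2
    rw [h2] at h1
    exact h1.unique hasSum_zero
  have hp := hs.one_sub
  have hpy {y : Op H} (hy : y ∈ M) : φ ((1 - s) * y) = φ y := by
    rw [sub_mul, one_mul, h.toIsPLF.map_sub hy (mul_mem hs.1 hy),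
      (h.toIsPLF.mul_eq_zero_of_null hs s0 hy).1, sub_zero]
  have hyp {y : Op H} (hy : y ∈ M) : φ (y * (1 - s)) = φ y := by
    rw [mul_sub, mul_one, h.toIsPLF.map_sub hy (mul_mem hy hs.1),
      (h.toIsPLF.mul_eq_zero_of_null hs s0 hy).2, sub_zero]
  refine ⟨1 - s, hp, fun x hx => by rw [mul_assoc, hpy (mul_mem hx hp.1), hyp hx],
    fun q hq hqφ => ?_⟩
  set p := 1 - s with hpdef
  set r := 1 - q with hrdef
  have hr : IsProjIn (M : Set (Op H)) r := hq.one_sub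
  have r0 : φ r = 0 := by
    rw [hrdef, h.toIsPLF.map_sub (one_mem M) hq.1, ← hqφ 1 (one_mem M), mul_one, hq.2.2, sub_self]
  by_contra hne
  have hx : p * r * p ∈ M := mul_mem (mul_mem hp.1 hr.1) hp.1
  have hxs : p * r * p = star (r * p) * (r * p) := by
    rw [star_mul, hp.2.1, hr.2.1, mul_assoc, mul_assoc, ← mul_assoc r, hr.2.2]
  have hx0 : p * r * p ≠ 0 := by
    rw [hxs, Ne, CStarRing.star_mul_self_eq_zero_iff]
    intro h0
    have h1 : p * r = 0 := hr.mul_eq_zero_symm hp h0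
    rw [hrdef, mul_sub, mul_one, sub_eq_zero] at h1
    exact hne h1.symm
  obtain ⟨e, y, he, e0, hy, -, hyx, hyc⟩ :=
    exists_cut_inverse hx (hxs ▸ star_mul_self_nonneg _) hx0
  have sp : s * p = 0 := by rw [hpdef, mul_sub, mul_one, hs.2.2, sub_self]
  have ps : p * s = 0 := by rw [hpdef, sub_mul, one_mul, hs.2.2, sub_self]
  have sx : s * (p * r * p) = 0 := by rw [mul_assoc, ← mul_assoc s, sp, zero_mul]
  have xs : p * r * p * s = 0 := by rw [mul_assoc, ps, mul_zero]
  have se : s * e = 0 := by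
    have h1 : y * s = s * y := hyc s (by rw [Commute, SemiconjBy, xs, sx])
    rw [← hyx, ← mul_assoc, ← mul_assoc, ← h1, mul_assoc y, sx, mul_zero, zero_mul]
  have φe : φ e = 0 := by
    have h1 : y * (p * r * p) = p * r * p * y := hyc _ (Commute.refl _)
    rw [← hyx, mul_assoc, ← h1, ← mul_assoc, ← mul_assoc,
      hyp (mul_mem (mul_mem hy hy) (mul_mem hp.1 hr.1)), ← mul_assoc,
      (h.toIsPLF.mul_eq_zero_of_null hr r0 (mul_mem (mul_mem hy hy) hp.1)).2]
  exact e0 (hmax e he (one_mul e) se φe)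

theorem IsNormalPLF.mono_algebra {N : VonNeumannAlgebra H} (hNM : ∀ x ∈ N, x ∈ M)
    (h : IsNormalPLF M φ) : IsNormalPLF N φ where
  map_add x hx y hy := h.map_add x (hNM x hx) y (hNM y hy)
  map_smul c x hx := h.map_smul c x (hNM x hx)
  pos x hx := h.pos x (hNM x hx)
  normal ι p q hp hq := h.normal ι p q (fun i => ⟨hNM _ (hp i).1, (hp i).2⟩) ⟨hNM _ hq.1, hq.2⟩

/-- The von Neumann algebra generated by a star subalgebra. -/
theorem exists_bicommutant (A : StarSubalgebra ℂ (Op H)) : ∃ C : VonNeumannAlgebra H,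
    Set.centralizer (Set.centralizer (A : Set (Op H))) = C := by
  have e : (StarSubalgebra.centralizer ℂ (StarSubalgebra.centralizer ℂ (A : Set (Op H)) :
      Set (Op H)) : Set (Op H)) = Set.centralizer (Set.centralizer (A : Set (Op H))) := by
    rw [StarSubalgebra.coe_centralizer_centralizer, StarMemClass.star_coe_eq, Set.union_self]
  refine ⟨⟨StarSubalgebra.centralizer ℂ (StarSubalgebra.centralizer ℂ (A : Set (Op H)) :
    Set (Op H)), ?_⟩, e.symm⟩
  change Set.centralizer (Set.centralizer (StarSubalgebra.centralizer ℂ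
    (StarSubalgebra.centralizer ℂ (A : Set (Op H)) : Set (Op H)) : Set (Op H))) =
    (StarSubalgebra.centralizer ℂ (StarSubalgebra.centralizer ℂ (A : Set (Op H)) :
      Set (Op H)) : Set (Op H))
  rw [e, Set.centralizer_centralizer_centralizer]

/-- The centralizer of a normal positive functional is a von Neumann algebra. -/
theorem exists_centralizer (h : IsNormalPLF M φ) : ∃ C : VonNeumannAlgebra H,
    ∀ y, y ∈ C ↔ y ∈ M ∧ ∀ x ∈ M, φ (y * x) = φ (x * y) := by
  let A : StarSubalgebra ℂ (Op H) :=
    { carrier := {y | y ∈ M ∧ ∀ x ∈ M, φ (y * x) = φ (x * y)}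
      mul_mem' := fun {a b} ha hb => ⟨mul_mem ha.1 hb.1, fun x hx => by
        rw [mul_assoc, ha.2 _ (mul_mem hb.1 hx), mul_assoc, hb.2 _ (mul_mem hx ha.1), mul_assoc]⟩
      one_mem' := ⟨one_mem M, fun x _ => by rw [one_mul, mul_one]⟩
      add_mem' := fun {a b} ha hb => ⟨add_mem ha.1 hb.1, fun x hx => by
        rw [add_mul, mul_add, h.map_add _ (mul_mem ha.1 hx) _ (mul_mem hb.1 hx),
          h.map_add _ (mul_mem hx ha.1) _ (mul_mem hx hb.1), ha.2 x hx, hb.2 x hx]⟩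
      zero_mem' := ⟨zero_mem M, fun x _ => by rw [zero_mul, mul_zero]⟩
      algebraMap_mem' := fun c => ⟨by
        rw [Algebra.algebraMap_eq_smul_one]
        exact vn_smul_mem c (one_mem M), fun x _ => by rw [Algebra.commutes c x]⟩
      star_mem' := fun {a} ha => ⟨star_mem ha.1, fun x hx => by
        have h1 := ha.2 (star x) (star_mem hx)
        have h2 := h.toIsPLF.map_star (mul_mem ha.1 (star_mem hx))
        have h3 := h.toIsPLF.map_star (mul_mem (star_mem hx) ha.1)
        rw [star_mul, star_star] at h2 h3
        rw [h2, h3, h1]⟩ }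
  have hAM : ∀ y ∈ A, y ∈ M := fun y hy => hy.1
  obtain ⟨C, hC⟩ := exists_bicommutant A
  have hCM : ∀ y ∈ C, y ∈ M := fun y hy => by
    rw [← SetLike.mem_coe, ← hC] at hy
    rw [← SetLike.mem_coe, ← M.centralizer_centralizer]
    exact Set.centralizer_subset (Set.centralizer_subset hAM) hy
  refine ⟨C, fun y => ⟨fun hy => ⟨hCM y hy, fun x hx => ?_⟩, fun hy => ?_⟩⟩
  · have hyM := hCM y hy
    have key : ∀ ε > 0, ‖φ (y * x) - φ (x * y)‖ ^ 2 ≤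
        ε * (2 * ((φ (star x * x)).re + (φ (x * star x)).re)) := by
      intro ε hε
      obtain ⟨a, ha, h1, h2⟩ := exists_approx hC (h.mono_algebra hCM) hy hε
      have hd : y - a ∈ M := sub_mem hyM ha.1
      have e : φ (y * x) - φ (x * y) = φ ((y - a) * x) - φ (x * (y - a)) := by
        rw [sub_mul, mul_sub, h.toIsPLF.map_sub (mul_mem hyM hx) (mul_mem ha.1 hx),
          h.toIsPLF.map_sub (mul_mem hx hyM) (mul_mem hx ha.1), ha.2 x hx]
        ring
      have c1 := h.toIsPLF.cauchy_schwarz hx hd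
      have c2 := h.toIsPLF.cauchy_schwarz hd hx
      have p1 := h.toIsPLF.re_nonneg hx
      have p2 := h.toIsPLF.re_nonneg (star_mem hx)
      rw [star_star] at p2
      have c1' := c1.trans (mul_le_mul_of_nonneg_right h2.le p1)
      have c2' := c2.trans (mul_le_mul_of_nonneg_left h1.le p2)
      rw [e]
      have t := norm_sub_le (φ ((y - a) * x)) (φ (x * (y - a)))
      have t2 := pow_le_pow_left₀ (norm_nonneg _) t 2
      nlinarith [sq_nonneg (‖φ ((y - a) * x)‖ - ‖φ (x * (y - a))‖)]
    have hz : ‖φ (y * x) - φ (x * y)‖ ^ 2 ≤ 0 := by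
      have h1 : Filter.Tendsto
          (fun ε : ℝ => ε * (2 * ((φ (star x * x)).re + (φ (x * star x)).re)))
          (nhdsWithin 0 (Set.Ioi 0)) (nhds 0) := by
        have : Continuous fun ε : ℝ => ε * (2 * ((φ (star x * x)).re + (φ (x * star x)).re)) := by
          fun_prop
        simpa using (this.tendsto 0).mono_left nhdsWithin_le_nhds
      exact ge_of_tendsto h1 (Filter.eventually_of_mem self_mem_nhdsWithin key)
    rw [← sub_eq_zero, ← norm_eq_zero]
    exact pow_eq_zero_iff two_ne_zero |>.1 (le_antisymm hz (by positivity))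
  · exact subset_bicommutant hC (show y ∈ A from hy)

/-- A bounded intertwiner, not necessarily a partial isometry, suffices. -/
theorem intertwined_of_bounded {ψ : Op H → ℂ} (hψ : IsNormalPLF M ψ) (hφ : IsNormalPLF M φ)
    {n : Op H} (hn : n ∈ M) {l : ℝ} (hl : 0 < l) (hne : ψ (n * star n) ≠ 0)
    (hrel : ∀ x ∈ M, ψ (n * x) = (l : ℂ) * φ (x * n)) : Intertwined M ψ φ := by
  obtain ⟨q, hq⟩ := exists_isSupportProjOf hψ
  obtain ⟨p, hp⟩ := exists_isSupportProjOf hφ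
  have supp {χ : Op H → ℂ} (hχ : IsNormalPLF M χ) {r : Op H} (hr : IsSupportProjOf M χ r)
      {y : Op H} (hy : y ∈ M) : χ (r * y) = χ y ∧ χ (y * r) = χ y := by
    have h0 : χ (1 - r) = 0 := by
      rw [hχ.toIsPLF.map_sub (one_mem M) hr.1.1, ← hr.2.1 1 (one_mem M), mul_one, hr.1.2.2,
        sub_self]
    have h1 := hχ.toIsPLF.mul_eq_zero_of_null hr.1.one_sub h0 hy
    rw [sub_mul, one_mul, mul_sub, mul_one, hχ.toIsPLF.map_sub hy (mul_mem hr.1.1 hy),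
      hχ.toIsPLF.map_sub hy (mul_mem hy hr.1.1), sub_eq_zero, sub_eq_zero] at h1
    exact ⟨h1.1.symm, h1.2.symm⟩
  have hlc : (l : ℂ) ≠ 0 := by exact_mod_cast hl.ne'
  obtain ⟨m, hm⟩ : ∃ m, m = q * n * p := ⟨_, rfl⟩
  have hmM : m ∈ M := hm ▸ mul_mem (mul_mem hq.1.1 hn) hp.1.1
  have hmrel : ∀ x ∈ M, ψ (m * x) = (l : ℂ) * φ (x * m) := by
    intro x hx
    have h1 : φ (x * q * n) = φ (x * n) := by
      refine mul_left_cancel₀ hlc ?_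
      rw [← hrel _ (mul_mem hx hq.1.1), ← hrel _ hx, ← mul_assoc,
        (supp hψ hq (mul_mem hn hx)).2]
    rw [hm, mul_assoc (q * n), mul_assoc q, (supp hψ hq (mul_mem hn (mul_mem hp.1.1 hx))).1,
      hrel _ (mul_mem hp.1.1 hx), mul_assoc, (supp hφ hp (mul_mem hx hn)).1, ← h1, ← mul_assoc,
      (supp hφ hp (mul_mem hx (mul_mem hq.1.1 hn))).2, mul_assoc]
  have hmne : ψ (m * star m) ≠ 0 := by
    have h1 : ψ (m * star m) = ψ (n * star n) := by
      have h2 : m * star m = q * (n * (p * star n)) * q := by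
        rw [hm, star_mul, star_mul, hp.1.2.1, hq.1.2.1]
        simp only [mul_assoc]
        rw [← mul_assoc p p, hp.1.2.2]
      have hx : p * star n ∈ M := mul_mem hp.1.1 (star_mem hn)
      rw [h2, hq.2.1 _ (mul_mem hn hx), hrel _ hx, hrel _ (star_mem hn), mul_assoc,
        (supp hφ hp (mul_mem (star_mem hn) hn)).1]
    rwa [h1]
  have qm : q * m = m := by rw [hm, ← mul_assoc, ← mul_assoc, hq.1.2.2]
  have mp : m * p = m := by rw [hm, mul_assoc, hp.1.2.2]
  have m0 : m ≠ 0 := fun h0 => hmne (by rw [h0, zero_mul, hψ.toIsPLF.map_zero])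
  obtain ⟨C, hC⟩ := exists_centralizer hφ
  have sm := star_mem hmM
  have hC1 : star m * m ∈ C := by
    refine (hC _).2 ⟨mul_mem sm hmM, fun x hx => ?_⟩
    refine mul_left_cancel₀ hlc ?_
    have h1 : ψ (m * (x * star m)) = (l : ℂ) * φ (x * (star m * m)) := by
      rw [hmrel _ (mul_mem hx sm), mul_assoc]
    have h2 : ψ (m * (star x * star m)) = (l : ℂ) * φ (star x * (star m * m)) := by
      rw [hmrel _ (mul_mem (star_mem hx) sm), mul_assoc]
    have h3 := hψ.toIsPLF.map_star (mul_mem hmM (mul_mem (star_mem hx) sm))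
    have h4 := hφ.toIsPLF.map_star (mul_mem (star_mem hx) (mul_mem sm hmM))
    simp only [star_mul, star_star] at h3 h4
    rw [h4, ← h1, ← mul_assoc m x, h3, h2, star_mul', Complex.star_def, Complex.conj_ofReal]
  obtain ⟨e, y, he, e0, hy, ys, yxy, yc⟩ := exists_cut_inverse hC1 (star_mul_self_nonneg m)
    (fun h0 => m0 (CStarRing.star_mul_self_eq_zero_iff m |>.1 h0))
  obtain ⟨hyM, hyφ⟩ := (hC y).1 hy
  have hsw : star (m * y) * (m * y) = e := by
    rw [star_mul, ys, ← yxy]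
    simp only [mul_assoc]
  have pm : p * star m = star m := by
    simpa [hp.1.2.1] using congr(star $mp)
  have yp : y * p = p * y := yc p (by
    rw [Commute, SemiconjBy, mul_assoc, mp, ← mul_assoc, pm])
  refine ⟨m * y, q, p, l, hl, mul_mem hmM hyM, ?_, ?_, hq, hp, ?_, ?_, fun x hx => ?_⟩
  · rw [IsPartialIsom, hsw, he.2.2]
  · intro h0
    rw [h0, mul_zero] at hsw
    exact e0 hsw.symm
  · rw [← mul_assoc, qm]
  · rw [mul_assoc, yp, ← mul_assoc, mp]
  · rw [mul_assoc, hmrel _ (mul_mem hyM hx), mul_assoc, hyφ _ (mul_mem hx hmM), mul_assoc]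

end Polar

/-! ### Hilbert space preliminaries -/

section Hilbert

theorem exists_hilbert_completion {V : Type} [AddCommGroup V] [Module ℂ V]
    (c : PreInnerProductSpace.Core ℂ V) : ∃ (K : Type) (_ : NormedAddCommGroup K)
      (_ : InnerProductSpace ℂ K) (_ : CompleteSpace K) (j : V →ₗ[ℂ] K),
      DenseRange j ∧ ∀ x y, inner ℂ (j x) (j y) = c.inner x y := by
  let _ : SeminormedAddCommGroup V :=
    @InnerProductSpace.Core.toSeminormedAddCommGroup ℂ V _ _ _ c
  let _ : InnerProductSpace ℂ V := InnerProductSpace.ofCore c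
  exact ⟨UniformSpace.Completion V, inferInstance, inferInstance, inferInstance,
    (UniformSpace.Completion.toComplL (𝕜 := ℂ) (E := V)).toLinearMap,
    UniformSpace.Completion.denseRange_coe, fun x y => UniformSpace.Completion.inner_coe x y⟩

variable {V K F : Type*} [AddCommGroup V] [Module ℂ V] [NormedAddCommGroup K]
  [InnerProductSpace ℂ K] [NormedAddCommGroup F] [NormedSpace ℂ F]

theorem exists_extension {j : V →ₗ[ℂ] K} (hj : DenseRange j) [CompleteSpace F] (f : V →ₗ[ℂ] F)
    (C : ℝ) (hf : ∀ x, ‖f x‖ ≤ C * ‖j x‖) : ∃ T : K →L[ℂ] F, ∀ x, T (j x) = f x :=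
  ⟨f.extendOfNorm j, LinearMap.extendOfNorm_eq hj ⟨C, hf⟩⟩

variable [CompleteSpace K]

/-- A nonzero compact self-adjoint operator has a common eigenvector with any symmetric operator
commuting with it. -/
theorem exists_common_eigenvector {C D : K →L[ℂ] K} (hC : IsCompactOperator C)
    (hCs : C.IsSymmetric) (hC0 : C ≠ 0) (hCD : ∀ η, C (D η) = D (C η)) :
    ∃ (η : K) (c d : ℂ), η ≠ 0 ∧ c ≠ 0 ∧ C η = c • η ∧ D η = d • η := by
  have h1 := mt (ContinuousLinearMap.eq_zero_of_forall_hasEigenvalue_eq_zero hC hCs).1 hC0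
  push Not at h1
  obtain ⟨c, hc, hc0⟩ := h1
  have hfin := ContinuousLinearMap.finite_dimensional_eigenspace hC c hc0
  set W := Module.End.eigenspace C.toLinearMap c with hW
  have hmem {η : K} : η ∈ W ↔ C η = c • η := Module.End.mem_eigenspace_iff
  have hinv : ∀ η ∈ W, D.toLinearMap η ∈ W := fun η hη => by
    rw [hmem] at hη ⊢
    change C (D η) = c • D η
    rw [hCD, hη, _root_.map_smul]
  have hnt : Nontrivial W := Submodule.nontrivial_iff_ne_bot.2 hc
  obtain ⟨d, hd⟩ := Module.End.exists_eigenvalue (D.toLinearMap.restrict hinv)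
  obtain ⟨η, hη⟩ := hd.exists_hasEigenvector
  refine ⟨η, c, d, fun h0 => hη.2 (Subtype.ext h0), hc0, hmem.1 η.2, ?_⟩
  exact congr(((↑) : W → K) $(hη.apply_eq_smul))

end Hilbert

section Forms

variable {M : VonNeumannAlgebra H} {φ : Op H → ℂ}

/-- The right-handed inner product attached to a positive linear functional. -/
noncomputable abbrev IsPLF.rightCore (h : IsPLF M φ) :
    PreInnerProductSpace.Core ℂ M.toStarSubalgebra where
  inner y x := φ ((x : Op H) * star (y : Op H))
  conj_inner_symm x y := by
    have := h.map_star_mul (star_mem x.2) (star_mem y.2)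
    rw [star_star, star_star] at this
    exact this.symm
  re_inner_nonneg x := by
    have := h.re_nonneg (star_mem x.2)
    rwa [star_star] at this
  add_left x y z := by
    simp only [AddMemClass.coe_add, star_add, mul_add]
    exact h.map_add _ (mul_mem z.2 (star_mem x.2)) _ (mul_mem z.2 (star_mem y.2))
  smul_left x y c := by
    have : (y : Op H) * star ((c • x : M.toStarSubalgebra) : Op H)
        = star c • ((y : Op H) * star (x : Op H)) := by simp
    rw [this, h.map_smul _ _ (mul_mem y.2 (star_mem x.2))]
    rfl

/-- The symmetrized inner product attached to a positive linear functional. -/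
noncomputable abbrev IsPLF.symmCore (h : IsPLF M φ) :
    PreInnerProductSpace.Core ℂ M.toStarSubalgebra where
  inner y x := h.core.inner y x + h.rightCore.inner y x
  conj_inner_symm x y := by
    exact (_root_.map_add (starRingEnd ℂ) _ _).trans
      (congrArg₂ _ (h.core.conj_inner_symm x y) (h.rightCore.conj_inner_symm x y))
  re_inner_nonneg x := by
    exact add_nonneg (h.core.re_inner_nonneg x) (h.rightCore.re_inner_nonneg x)
  add_left x y z := by
    rw [h.core.add_left, h.rightCore.add_left]
    ring
  smul_left x y c := by
    rw [h.core.smul_left, h.rightCore.smul_left]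
    ring

/-- The symmetrized GNS space of a positive functional, with the bounded positive operator
implementing the left GNS form. -/
theorem exists_symm_gns (h : IsPLF M φ) : ∃ (K : Type) (_ : NormedAddCommGroup K)
    (_ : InnerProductSpace ℂ K) (_ : CompleteSpace K) (j : M.toStarSubalgebra →ₗ[ℂ] K)
    (D : K →L[ℂ] K), DenseRange j ∧
    (∀ x y : M.toStarSubalgebra, inner ℂ (j x) (j y) =
      φ (star (x : Op H) * y) + φ ((y : Op H) * star (x : Op H))) ∧
    (∀ x y : M.toStarSubalgebra, inner ℂ (j x) (D (j y)) = φ (star (x : Op H) * y)) ∧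
    D.IsSymmetric ∧ ∀ η, ∃ r : ℝ, 0 ≤ r ∧ r ≤ ‖η‖ ^ 2 ∧ inner ℂ η (D η) = (r : ℂ) := by
  obtain ⟨K, _, _, _, j, hj, hji⟩ := exists_hilbert_completion h.symmCore
  obtain ⟨L, _, _, _, k, hk, hki⟩ := exists_hilbert_completion h.core
  have hki' (x y : M.toStarSubalgebra) : inner ℂ (k x) (k y) = φ (star (x : Op H) * y) :=
    hki x y
  have hji' (x y : M.toStarSubalgebra) : inner ℂ (j x) (j y) =
      φ (star (x : Op H) * y) + φ ((y : Op H) * star (x : Op H)) := hji x y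
  have hle (x : M.toStarSubalgebra) : ‖k x‖ ≤ 1 * ‖j x‖ := by
    have h1 := inner_self_eq_norm_sq (𝕜 := ℂ) (k x)
    have h2 := inner_self_eq_norm_sq (𝕜 := ℂ) (j x)
    rw [hki'] at h1
    rw [hji', map_add, h1] at h2
    have h3 := h.re_nonneg (star_mem x.2)
    rw [star_star] at h3
    have h4 : RCLike.re (φ ((x : Op H) * star (x : Op H))) =
      (φ ((x : Op H) * star (x : Op H))).re := rfl
    rw [one_mul, ← pow_le_pow_iff_left₀ (norm_nonneg _) (norm_nonneg _) two_ne_zero]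
    linarith
  obtain ⟨B, hB⟩ := exists_extension hj k 1 hle
  have hBn (η : K) : ‖B η‖ ≤ ‖η‖ :=
    hj.induction_on (p := fun η => ‖B η‖ ≤ ‖η‖) η
      (isClosed_le (by fun_prop) (by fun_prop)) fun x => by
        rw [hB]
        simpa using hle x
  refine ⟨K, inferInstance, inferInstance, inferInstance, j,
    (ContinuousLinearMap.adjoint B) ∘L B, hj, hji', fun x y => ?_, fun η ζ => ?_, fun η => ?_⟩
  · rw [ContinuousLinearMap.comp_apply, ContinuousLinearMap.adjoint_inner_right, hB, hB, hki']
  · change inner ℂ (ContinuousLinearMap.adjoint B (B η)) ζ =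
      inner ℂ η (ContinuousLinearMap.adjoint B (B ζ))
    rw [ContinuousLinearMap.adjoint_inner_right, ContinuousLinearMap.adjoint_inner_left]
  · refine ⟨‖B η‖ ^ 2, by positivity, by gcongr; exact hBn η, ?_⟩
    rw [ContinuousLinearMap.comp_apply, ContinuousLinearMap.adjoint_inner_right,
      inner_self_eq_norm_sq_to_K]
    norm_cast

/-- The right-handed GNS space of a positive functional. -/
theorem exists_right_gns (h : IsPLF M φ) : ∃ (K : Type) (_ : NormedAddCommGroup K)
    (_ : InnerProductSpace ℂ K) (_ : CompleteSpace K)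
    (k : M.toStarSubalgebra.toSubalgebra.toSubmodule →L[ℂ] K),
    ∀ x y : M.toStarSubalgebra.toSubalgebra.toSubmodule, inner ℂ (k x) (k y) =
      φ ((y : Op H) * star (x : Op H)) := by
  obtain ⟨K, _, _, _, k, -, hk⟩ := exists_hilbert_completion h.rightCore
  let k' : M.toStarSubalgebra.toSubalgebra.toSubmodule →ₗ[ℂ] K :=
    { toFun := fun x => k ⟨x, x.2⟩
      map_add' := fun x y => k.map_add ⟨x, x.2⟩ ⟨y, y.2⟩
      map_smul' := fun c x => k.map_smul c ⟨x, x.2⟩ }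
  refine ⟨K, inferInstance, inferInstance, inferInstance,
    k'.mkContinuous (√(φ 1).re) fun x => ?_, fun x y => hk _ _⟩
  have h1 := inner_self_eq_norm_sq (𝕜 := ℂ) (k' x)
  have h2 := h.star_mul_self_le (star_mem x.2)
  rw [norm_star, star_star] at h2
  rw [← pow_le_pow_iff_left₀ (norm_nonneg _) (by positivity) two_ne_zero]
  rw [mul_pow, Real.sq_sqrt h.one_re_nonneg, ← h1, mul_comm (φ 1).re]
  exact (congrArg Complex.re (hk _ _)).trans_le h2

end Forms

/-! ### Slices of elements of a tensor product -/

section Slice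

variable {M N P : VonNeumannAlgebra H} {φ ψ : Op H → ℂ} {E : Op H → Op H}

theorem isNormalPLF_inner (N : VonNeumannAlgebra H) (ξ : H) :
    IsNormalPLF N fun x => inner ℂ ξ (x ξ) where
  map_add x _ y _ := by simp
  map_smul c x _ := by simp
  pos x _ := by
    have h1 := (ContinuousLinearMap.nonneg_iff_isPositive _).1 (star_mul_self_nonneg x)
    exact h1.inner_nonneg_right ξ
  normal _ _ _ _ _ _ hs := (hs ξ).mapL (innerSL ℂ ξ)

theorem IsPLF.comp_condExp (hE : IsCondExp M N E) (h : IsPLF N ψ) :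
    IsPLF M fun x => ψ (E x) where
  map_add x hx y hy := by
    simp only [hE.map_add' x hx y hy]
    exact h.map_add _ (hE.mem' x hx) _ (hE.mem' y hy)
  map_smul c x hx := by
    simp only [hE.map_smul' c x hx]
    exact h.map_smul _ _ (hE.mem' x hx)
  pos x hx := h.nonneg (hE.mem' _ (mul_mem (star_mem hx) hx))
    ((ContinuousLinearMap.nonneg_iff_isPositive _).2 (hE.pos' _ (mul_mem (star_mem hx) hx)
      ((ContinuousLinearMap.nonneg_iff_isPositive _).1 (star_mul_self_nonneg x))))

theorem IsNormalPLF.comp_condExp (hE : IsCondExp M N E) (h : IsNormalPLF N ψ) :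
    IsNormalPLF M fun x => ψ (E x) where
  toIsPLF := h.toIsPLF.comp_condExp hE
  normal ι p q hp hq ho hs := by
    have h1 : ψ 1 = ((ψ 1).re : ℂ) := by simpa using h.toIsPLF.eq_re (one_mem N)
    rcases h.toIsPLF.one_re_nonneg.eq_or_lt with h0 | h0
    · have hz {x : Op H} (hx : x ∈ M) : ψ (E x) = 0 := by
        have := h.toIsPLF.norm_le (hE.mem' x hx)
        rw [← h0, zero_mul] at this
        exact norm_le_zero_iff.1 this
      simp only [hz (hp _).1, hz hq.1]
      exact hasSum_zero
    · have hc : ((ψ 1).re : ℂ) ≠ 0 := by exact_mod_cast h0.ne'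
      have hρ : IsNormalState N fun x => (((ψ 1).re⁻¹ : ℝ) : ℂ) * ψ x :=
        { left :=
            { map_add := fun x hx y hy => by simp only [h.map_add x hx y hy, mul_add]
              map_smul := fun c x hx => by simp only [h.map_smul c x hx]; ring
              pos := fun x hx => mul_nonneg (by exact_mod_cast (inv_pos.2 h0).le) (h.pos x hx)
              normal := fun ι p q hp hq ho hs => (h.normal ι p q hp hq ho hs).mul_left _ }
          right := by
            change _ * ψ 1 = 1
            rw [h1, Complex.ofReal_re, Complex.ofReal_inv, inv_mul_cancel₀ hc] }
      have h2 := ((hE.normal' _ hρ).1.normal ι p q hp hq ho hs).mul_left ((ψ 1).re : ℂ)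
      simpa only [Complex.ofReal_inv, mul_inv_cancel_left₀ hc] using h2

theorem slice_re_le (hdec : IsTensorDecomposition M N P) (hE : IsSliceExpectation M N P φ E)
    (hφ : IsPLF P φ) (hψ : IsPLF N ψ) {b y : Op H} (hb : b ∈ M) (hy : y ∈ P) :
    (ψ (E (b * y) * star (E (b * y)))).re ≤
      (ψ (E (b * star b))).re * (φ (star y * y)).re := by
  have hyM := hdec.subP hy
  have hby := mul_mem hb hyM
  obtain ⟨x, hx⟩ : ∃ x, x = star (E (b * y)) := ⟨_, rfl⟩
  have hxN : x ∈ N := hx ▸ star_mem (hE.1.mem' _ hby)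
  have hxM := hdec.subN hxN
  have h1 : E (b * (y * x)) = E (b * y) * x := by
    simpa [mul_assoc] using hE.1.bimod' 1 (one_mem N) _ hby x hxN
  have h2 : E (star (y * x) * (y * x)) = φ (star y * y) • (star x * x) := by
    have hyy := mul_mem (star_mem hy) hy
    rw [← hE.2 _ (mul_mem (star_mem hxN) hxN) _ hyy, star_mul, mul_assoc, ← mul_assoc (star y),
      ← hdec.comm x hxN _ hyy, mul_assoc]
  have h3 := (hψ.comp_condExp hE.1).cauchy_schwarz (mul_mem hyM hxM) hb
  have h4 : E (b * y) = star x := by rw [hx, star_star]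
  have hxx := mul_mem (star_mem hxN) hxN
  simp only [h1, h2, h4, hψ.map_smul _ _ hxx] at h3
  rw [hψ.eq_re hxN, hφ.eq_re hy, ← Complex.ofReal_mul, Complex.ofReal_re, Complex.norm_real,
    Real.norm_eq_abs, sq_abs] at h3
  rw [h4, star_star]
  rcases (hψ.re_nonneg hxN).eq_or_lt with h0 | h0
  · rw [← h0]
    have := (hψ.comp_condExp hE.1).re_nonneg (star_mem hb)
    rw [star_star] at this
    exact mul_nonneg this (hφ.re_nonneg hy)
  · nlinarith

theorem slice_norm_sq_le (hdec : IsTensorDecomposition M N P) (hE : IsSliceExpectation M N P φ E)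
    (hφ : IsPLF P φ) {b y : Op H} (hb : b ∈ M) (hy : y ∈ P) :
    ‖E (b * y)‖ ^ 2 ≤ ‖E (b * star b)‖ * (φ (star y * y)).re := by
  have h0 := hφ.re_nonneg hy
  rw [← norm_star, ← Real.le_sqrt (norm_nonneg _) (by positivity)]
  refine ContinuousLinearMap.opNorm_le_bound _ (Real.sqrt_nonneg _) fun ξ => ?_
  rw [← pow_le_pow_iff_left₀ (norm_nonneg _) (by positivity) two_ne_zero, mul_pow,
    Real.sq_sqrt (by positivity)]
  have h1 := slice_re_le hdec hE hφ (isNormalPLF_inner N ξ).toIsPLF hb hy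
  have h2 : (inner ℂ ξ ((E (b * y) * star (E (b * y))) ξ)).re = ‖star (E (b * y)) ξ‖ ^ 2 := by
    rw [mul_apply_eq_comp, ← ContinuousLinearMap.adjoint_inner_left]
    exact inner_self_eq_norm_sq (𝕜 := ℂ) _
  have h3 : (inner ℂ ξ ((E (b * star b)) ξ)).re ≤ ‖E (b * star b)‖ * ‖ξ‖ ^ 2 :=
    calc _ ≤ ‖inner ℂ ξ ((E (b * star b)) ξ)‖ := Complex.re_le_norm _
      _ ≤ ‖ξ‖ * ‖E (b * star b) ξ‖ := norm_inner_le_norm _ _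
      _ ≤ ‖ξ‖ * (‖E (b * star b)‖ * ‖ξ‖) := by gcongr; exact ContinuousLinearMap.le_opNorm _ _
      _ = _ := by ring
  rw [h2] at h1
  calc _ ≤ _ := h1
    _ ≤ ‖E (b * star b)‖ * ‖ξ‖ ^ 2 * (φ (star y * y)).re := by gcongr
    _ = _ := by ring

/-- The `*`-algebra spanned by products of the two tensor factors. -/
theorem exists_product_algebra (hdec : IsTensorDecomposition M N P) :
    ∃ A : StarSubalgebra ℂ (Op H), Set.centralizer (Set.centralizer (A : Set (Op H))) = M ∧
      ∀ p : Op H → Prop, (∀ x ∈ N, ∀ y ∈ P, p (x * y)) →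
        (∀ a ∈ M, ∀ b ∈ M, p a → p b → p (a + b)) → ∀ a ∈ A, p a := by
  let n := N.toStarSubalgebra.toSubalgebra
  let r := P.toStarSubalgebra.toSubalgebra
  let m := M.toStarSubalgebra.toSubalgebra
  have hnr : r.toSubmodule * n.toSubmodule ≤ n.toSubmodule * r.toSubmodule :=
    Submodule.mul_le.2 fun y hy x hx => hdec.comm x hx y hy ▸ Submodule.mul_mem_mul hx hy
  have hm : n.toSubmodule * r.toSubmodule ≤ m.toSubmodule :=
    Submodule.mul_le.2 fun x hx y hy => mul_mem (s := M) (hdec.subN hx) (hdec.subP hy)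
  have hmul : (n.toSubmodule * r.toSubmodule) * (n.toSubmodule * r.toSubmodule) ≤
      n.toSubmodule * r.toSubmodule :=
    calc _ = n.toSubmodule * (r.toSubmodule * n.toSubmodule) * r.toSubmodule := by
          simp only [mul_assoc]
      _ ≤ n.toSubmodule * (n.toSubmodule * r.toSubmodule) * r.toSubmodule := by gcongr
      _ = (n.toSubmodule * n.toSubmodule) * (r.toSubmodule * r.toSubmodule) := by
          simp only [mul_assoc]
      _ = _ := by rw [n.isIdempotentElem_toSubmodule.eq, r.isIdempotentElem_toSubmodule.eq]
  let A : StarSubalgebra ℂ (Op H) :=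
    { carrier := n.toSubmodule * r.toSubmodule
      mul_mem' := fun ha hb => hmul (Submodule.mul_mem_mul ha hb)
      add_mem' := fun ha hb => add_mem ha hb
      algebraMap_mem' := fun c => by
        rw [Algebra.algebraMap_eq_smul_one, ← mul_one (1 : Op H)]
        exact Submodule.smul_mem _ _ (Submodule.mul_mem_mul (one_mem n) (one_mem r))
      star_mem' := fun {a} ha => Submodule.mul_induction_on ha
        (fun x hx y hy => by
          rw [star_mul, ← hdec.comm _ (star_mem (s := N) hx) _ (star_mem (s := P) hy)]
          exact Submodule.mul_mem_mul (star_mem (s := N) hx) (star_mem (s := P) hy))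
        (fun a b ha hb => by
          rw [star_add]
          exact add_mem (S := Submodule ℂ (Op H)) ha hb) }
  have hAM : (A : Set (Op H)) ⊆ M := fun a ha => hm ha
  refine ⟨A, Set.Subset.antisymm ?_ ?_, fun p hp hadd a ha => ?_⟩
  · rw [← M.centralizer_centralizer]
    exact Set.centralizer_subset (Set.centralizer_subset hAM)
  · rw [← hdec.generates]
    refine Set.centralizer_subset (Set.centralizer_subset (Set.union_subset ?_ ?_))
    · intro x hx
      rw [← mul_one x]
      exact Submodule.mul_mem_mul (M := n.toSubmodule) hx (one_mem r)
    · intro y hy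
      rw [← one_mul y]
      exact Submodule.mul_mem_mul (N := r.toSubmodule) (one_mem n) hy
  · suffices h : a ∈ M ∧ p a from h.2
    exact Submodule.mul_induction_on (C := fun a => a ∈ M ∧ p a) ha
      (fun x hx y hy => ⟨mul_mem (hdec.subN hx) (hdec.subP hy), hp x hx y hy⟩)
      (fun a b ha hb => ⟨add_mem ha.1 hb.1, hadd a ha.1 b hb.1 ha.2 hb.2⟩)

end Slice

/-! ### Slice maps -/

section SliceMaps

variable {M N P : VonNeumannAlgebra H} {φ ψ : Op H → ℂ} {E : Op H → Op H}
  {K : Type} [NormedAddCommGroup K] [InnerProductSpace ℂ K]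
  {j : P.toStarSubalgebra →ₗ[ℂ] K} {a b : Op H} {T S T' S' : K →L[ℂ] Op H}

theorem IsCondExp.map_sub (hE : IsCondExp M N E) {x y : Op H} (hx : x ∈ M) (hy : y ∈ M) :
    E (x - y) = E x - E y := by
  have h := hE.map_smul' (-1) y hy
  rw [neg_one_smul, neg_one_smul] at h
  rw [sub_eq_add_neg, hE.map_add' x hx _ (neg_mem hy), h, sub_eq_add_neg]

/-- `T` and `S` are the maps `y ↦ E (b y)` and `y ↦ E (y b)` on a completion `K` of `P`. -/
structure IsSlicePair (E : Op H → Op H) (j : P.toStarSubalgebra →ₗ[ℂ] K) (b : Op H)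
    (T S : K →L[ℂ] Op H) : Prop where
  left : ∀ y, T (j y) = E (b * y)
  right : ∀ y, S (j y) = E (y * b)

namespace IsSlicePair

theorem add (hdec : IsTensorDecomposition M N P) (hE : IsCondExp M N E) (ha : a ∈ M) (hb : b ∈ M)
    (h : IsSlicePair E j a T S) (h' : IsSlicePair E j b T' S') :
    IsSlicePair E j (a + b) (T + T') (S + S') where
  left y := by
    rw [add_apply, h.left, h'.left, add_mul,
      hE.map_add' _ (mul_mem ha (hdec.subP y.2)) _ (mul_mem hb (hdec.subP y.2))]
  right y := by
    rw [add_apply, h.right, h'.right, mul_add,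
      hE.map_add' _ (mul_mem (hdec.subP y.2) ha) _ (mul_mem (hdec.subP y.2) hb)]

theorem sub (hdec : IsTensorDecomposition M N P) (hE : IsCondExp M N E) (ha : a ∈ M) (hb : b ∈ M)
    (h : IsSlicePair E j a T S) (h' : IsSlicePair E j b T' S') :
    IsSlicePair E j (a - b) (T - T') (S - S') where
  left y := by
    rw [sub_apply, h.left, h'.left, sub_mul,
      hE.map_sub (mul_mem ha (hdec.subP y.2)) (mul_mem hb (hdec.subP y.2))]
  right y := by
    rw [sub_apply, h.right, h'.right, mul_sub,
      hE.map_sub (mul_mem (hdec.subP y.2) ha) (mul_mem (hdec.subP y.2) hb)]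

theorem mem (hdec : IsTensorDecomposition M N P) (hE : IsCondExp M N E) (hj : DenseRange j)
    (hb : b ∈ M) (h : IsSlicePair E j b T S) (η : K) : T η ∈ N ∧ S η ∈ N := by
  refine ⟨hj.induction_on η ((vn_isClosed N).preimage T.continuous) fun y => ?_,
    hj.induction_on η ((vn_isClosed N).preimage S.continuous) fun y => ?_⟩
  · rw [h.left]
    exact hE.mem' _ (mul_mem hb (hdec.subP y.2))
  · rw [h.right]
    exact hE.mem' _ (mul_mem (hdec.subP y.2) hb)

end IsSlicePair

/-- `j : P → K` is the symmetrized GNS map of `φ`, and `E` slices `M = N ⊗ P` along `φ`. -/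
structure IsSliceGNS (M N P : VonNeumannAlgebra H) (φ : Op H → ℂ) (E : Op H → Op H)
    (j : P.toStarSubalgebra →ₗ[ℂ] K) : Prop where
  dec : IsTensorDecomposition M N P
  exp : IsSliceExpectation M N P φ E
  plf : IsPLF P φ
  dense : DenseRange j
  inner_eq (x y : P.toStarSubalgebra) : inner ℂ (j x) (j y) =
    φ (star (x : Op H) * y) + φ ((y : Op H) * star (x : Op H))

namespace IsSliceGNS

theorem re_le_norm_sq (h : IsSliceGNS M N P φ E j) (y : P.toStarSubalgebra) :
    (φ (star (y : Op H) * y)).re ≤ ‖j y‖ ^ 2 ∧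
      (φ ((y : Op H) * star (y : Op H))).re ≤ ‖j y‖ ^ 2 := by
  have h1 : (inner ℂ (j y) (j y)).re = ‖j y‖ ^ 2 := inner_self_eq_norm_sq (𝕜 := ℂ) _
  rw [h.inner_eq, Complex.add_re] at h1
  have h2 := h.plf.re_nonneg y.2
  have h3 := h.plf.re_nonneg (star_mem y.2)
  rw [star_star] at h3
  constructor <;> linarith

theorem star_slice (h : IsSliceGNS M N P φ E j) (hb : b ∈ M) {y : Op H} (hy : y ∈ P) :
    E (y * b) = star (E (star b * star y)) := by
  rw [← h.exp.1.map_star' _ (mul_mem (star_mem hb) (star_mem (h.dec.subP hy))), star_mul,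
    star_star, star_star]

theorem exists_isSlicePair (h : IsSliceGNS M N P φ E j) (hb : b ∈ M) :
    ∃ T S, IsSlicePair E j b T S := by
  let f : P.toStarSubalgebra →ₗ[ℂ] Op H :=
    { toFun := fun y => E (b * y)
      map_add' := fun x y => by
        rw [AddMemClass.coe_add, mul_add]
        exact h.exp.1.map_add' _ (mul_mem hb (h.dec.subP x.2)) _ (mul_mem hb (h.dec.subP y.2))
      map_smul' := fun c y => by
        change E (b * (c • (y : Op H))) = _
        rw [mul_smul_comm]
        exact h.exp.1.map_smul' _ _ (mul_mem hb (h.dec.subP y.2)) }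
  let g : P.toStarSubalgebra →ₗ[ℂ] Op H :=
    { toFun := fun y => E (y * b)
      map_add' := fun x y => by
        rw [AddMemClass.coe_add, add_mul]
        exact h.exp.1.map_add' _ (mul_mem (h.dec.subP x.2) hb) _ (mul_mem (h.dec.subP y.2) hb)
      map_smul' := fun c y => by
        change E ((c • (y : Op H)) * b) = _
        rw [smul_mul_assoc]
        exact h.exp.1.map_smul' _ _ (mul_mem (h.dec.subP y.2) hb) }
  have hf (y : P.toStarSubalgebra) : ‖f y‖ ≤ √‖E (b * star b)‖ * ‖j y‖ := by
    rw [← pow_le_pow_iff_left₀ (norm_nonneg _) (by positivity) two_ne_zero, mul_pow,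
      Real.sq_sqrt (norm_nonneg _)]
    exact (slice_norm_sq_le h.dec h.exp h.plf hb y.2).trans
      (mul_le_mul_of_nonneg_left (h.re_le_norm_sq y).1 (norm_nonneg _))
  have hg (y : P.toStarSubalgebra) : ‖g y‖ ≤ √‖E (star b * b)‖ * ‖j y‖ := by
    rw [← pow_le_pow_iff_left₀ (norm_nonneg _) (by positivity) two_ne_zero, mul_pow,
      Real.sq_sqrt (norm_nonneg _)]
    change ‖E (y * b)‖ ^ 2 ≤ _
    rw [h.star_slice hb y.2, norm_star]
    have h1 := slice_norm_sq_le h.dec h.exp h.plf (star_mem hb) (star_mem y.2)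
    rw [star_star, star_star] at h1
    exact h1.trans (mul_le_mul_of_nonneg_left (h.re_le_norm_sq y).2 (norm_nonneg _))
  obtain ⟨T, hT⟩ := exists_extension h.dense f _ hf
  obtain ⟨S, hS⟩ := exists_extension h.dense g _ hg
  exact ⟨T, S, hT, hS⟩

theorem norm_sq_le (h : IsSliceGNS M N P φ E j) (hψ : IsPLF N ψ) (hb : b ∈ M)
    (hp : IsSlicePair E j b T S) {f : Op H →L[ℂ] ℂ} (hf : ∀ x ∈ N, f x = ψ x) (η : K) :
    ‖f (T η)‖ ^ 2 ≤ (ψ (E (b * star b))).re * (ψ 1).re * ‖η‖ ^ 2 ∧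
      ‖f (S η)‖ ^ 2 ≤ (ψ (E (star b * b))).re * (ψ 1).re * ‖η‖ ^ 2 := by
  have hω := hψ.comp_condExp h.exp.1
  have hφE {y : Op H} (hy : y ∈ P) : ψ (E y) = φ y * ψ 1 := by
    rw [← hψ.map_smul _ _ (one_mem N), ← h.exp.2 1 (one_mem N) y hy, one_mul]
  have h10 := hψ.one_re_nonneg
  have h1 : ψ 1 = ((ψ 1).re : ℂ) := by simpa using hψ.eq_re (one_mem N)
  have hre {y : Op H} (hy : y ∈ P) : (ψ (E y)).re = (φ y).re * (ψ 1).re := by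
    rw [hφE hy, h1, Complex.re_mul_ofReal, Complex.ofReal_re]
  constructor
  · refine h.dense.induction_on (p := fun η => ‖f (T η)‖ ^ 2 ≤ _ * ‖η‖ ^ 2) η
      (isClosed_le (by fun_prop) (by fun_prop)) fun y => ?_
    have hyM := h.dec.subP y.2
    rw [hp.left, hf _ (h.exp.1.mem' _ (mul_mem hb hyM)), mul_assoc]
    refine (hω.cauchy_schwarz hyM hb).trans (mul_le_mul_of_nonneg_left ?_ ?_)
    · rw [hre (mul_mem (star_mem y.2) y.2), mul_comm]
      exact mul_le_mul_of_nonneg_left (h.re_le_norm_sq y).1 h10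
    · simpa using hω.re_nonneg (star_mem hb)
  · refine h.dense.induction_on (p := fun η => ‖f (S η)‖ ^ 2 ≤ _ * ‖η‖ ^ 2) η
      (isClosed_le (by fun_prop) (by fun_prop)) fun y => ?_
    have hyM := h.dec.subP y.2
    rw [hp.right, hf _ (h.exp.1.mem' _ (mul_mem hyM hb)), mul_assoc]
    refine (hω.cauchy_schwarz hb hyM).trans ?_
    rw [mul_comm, hre (mul_mem y.2 (star_mem y.2)), mul_comm (φ _).re]
    exact mul_le_mul_of_nonneg_left
      (mul_le_mul_of_nonneg_left (h.re_le_norm_sq y).2 h10) (hω.re_nonneg hb)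

/-- The left slice map of `b` is small for the norm `ψ (x x*)` if `b b*` is small for `ψ ∘ E`. -/
theorem re_le (h : IsSliceGNS M N P φ E j) (hψ : IsPLF N ψ) (hb : b ∈ M)
    (hp : IsSlicePair E j b T S) {f : Op H →L[ℂ] ℂ} (hf : ∀ x ∈ N, f x = ψ x) (η : K) :
    (ψ (T η * star (T η))).re ≤ (ψ (E (b * star b))).re * ‖η‖ ^ 2 := by
  have hT := (hp.mem h.dec h.exp.1 h.dense hb · |>.1)
  rw [← hf _ (mul_mem (hT η) (star_mem (hT η)))]
  refine h.dense.induction_on (p := fun η => (f (T η * star (T η))).re ≤ _ * ‖η‖ ^ 2) η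
    (isClosed_le (by fun_prop) (by fun_prop)) fun y => ?_
  rw [hf _ (mul_mem (hT _) (star_mem (hT _))), hp.left]
  refine (slice_re_le h.dec h.exp h.plf hψ hb y.2).trans
    (mul_le_mul_of_nonneg_left (h.re_le_norm_sq y).1 ?_)
  simpa using (hψ.comp_condExp h.exp.1).re_nonneg (star_mem hb)

variable {D : K →L[ℂ] K}

/-- Slice maps of elements of the algebraic tensor product have finite rank. -/
theorem exists_isSlicePair_mul (h : IsSliceGNS M N P φ E j)
    (hD : ∀ x y : P.toStarSubalgebra, inner ℂ (j x) (D (j y)) = φ (star (x : Op H) * y))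
    {x y : Op H} (hx : x ∈ N) (hy : y ∈ P) : ∃ T S, IsSlicePair E j (x * y) T S ∧
      (∀ η, T η = (T + S) (D η)) ∧ IsCompactOperator T := by
  let u : P.toStarSubalgebra := ⟨star y, star_mem hy⟩
  let R : K →L[ℂ] Op H := (innerSL ℂ (j u)).smulRight x
  have hR (η : K) : R η = inner ℂ (j u) η • x := rfl
  refine ⟨R ∘L D, R - R ∘L D, ⟨fun z => ?_, fun z => ?_⟩, fun η => by simp, ?_⟩
  · rw [ContinuousLinearMap.comp_apply, hR, hD, star_star, mul_assoc,
      h.exp.2 x hx _ (mul_mem hy z.2)]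
  · rw [sub_apply, ContinuousLinearMap.comp_apply, hR, hR, hD, h.inner_eq, ← sub_smul,
      add_sub_cancel_left, star_star, ← mul_assoc, ← h.dec.comm x hx _ z.2, mul_assoc,
      h.exp.2 x hx _ (mul_mem z.2 hy)]
  · have h1 : IsCompactOperator ((innerSL ℂ (j u)).smulRight x) :=
      IsCompactOperator.clm_comp (f := innerSL ℂ (j u))
        (isCompactOperator_of_locallyCompactSpace_dom (innerSL ℂ (j u)))
        (ContinuousLinearMap.toSpanSingleton ℂ x)
    exact h1.comp_clm D

theorem exists_isSlicePair_compact (h : IsSliceGNS M N P φ E j)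
    (hD : ∀ x y : P.toStarSubalgebra, inner ℂ (j x) (D (j y)) = φ (star (x : Op H) * y)) :
    ∃ A : StarSubalgebra ℂ (Op H), Set.centralizer (Set.centralizer (A : Set (Op H))) = M ∧
      ∀ a ∈ A, ∃ T S, IsSlicePair E j a T S ∧ (∀ η, T η = (T + S) (D η)) ∧
        IsCompactOperator T := by
  obtain ⟨A, hA, hind⟩ := exists_product_algebra h.dec
  refine ⟨A, hA, hind _ (fun x hx y hy => h.exists_isSlicePair_mul hD hx hy) ?_⟩
  rintro a ha b hb ⟨T, S, hp, hr, hc⟩ ⟨T', S', hp', hr', hc'⟩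
  refine ⟨T + T', S + S', hp.add h.dec h.exp.1 ha hb hp', fun η => ?_, hc.add hc'⟩
  rw [add_apply, hr, hr']
  simp only [add_apply]
  abel

/-- The left slice map is determined by the sum of both slice maps. -/
theorem slice_relation (h : IsSliceGNS M N P φ E j)
    (hD : ∀ x y : P.toStarSubalgebra, inner ℂ (j x) (D (j y)) = φ (star (x : Op H) * y))
    {v : Op H} (hv : v ∈ M) (hp : IsSlicePair E j v T S) (η : K) : T η = (T + S) (D η) := by
  obtain ⟨A, hA, hAc⟩ := h.exists_isSlicePair_compact hD
  have key {ψ : Op H → ℂ} (hψ : IsNormalPLF N ψ) {f : Op H →L[ℂ] ℂ} (hf : ∀ x ∈ N, f x = ψ x) :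
      f (T η - (T + S) (D η)) = 0 := by
    by_contra h0
    obtain ⟨w, hw⟩ : ∃ w, w = ‖f (T η - (T + S) (D η))‖ := ⟨_, rfl⟩
    have w0 : 0 < w := hw ▸ norm_pos_iff.2 h0
    have hc := hψ.toIsPLF.one_re_nonneg
    obtain ⟨Q, hQ⟩ : ∃ Q, Q = 3 * ((ψ 1).re * (‖η‖ ^ 2 + 2 * ‖D η‖ ^ 2)) := ⟨_, rfl⟩
    have Q0 : 0 ≤ Q := by rw [hQ]; positivity
    obtain ⟨ε, hε⟩ : ∃ ε, ε = w ^ 2 / (Q + 1) := ⟨_, rfl⟩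
    have ε0 : 0 < ε := by rw [hε]; positivity
    obtain ⟨a, ha, h1, h2⟩ := exists_approx hA (hψ.comp_condExp h.exp.1) hv ε0
    obtain ⟨T', S', hp', hr, -⟩ := hAc a ha
    have haM : a ∈ M := subset_bicommutant hA ha
    have hb := hp.sub h.dec h.exp.1 hv haM hp'
    have hle := h.norm_sq_le hψ.toIsPLF (sub_mem hv haM) hb hf
    have e : T η - (T + S) (D η) = (T - T') η - (T - T') (D η) - (S - S') (D η) := by
      rw [sub_apply, hr]
      simp only [add_apply, sub_apply]
      abel
    have h3 : w ≤ ‖f ((T - T') η)‖ + ‖f ((T - T') (D η))‖ + ‖f ((S - S') (D η))‖ := by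
      rw [hw, e, map_sub, map_sub]
      exact (norm_sub_le _ _).trans (by gcongr; exact norm_sub_le _ _)
    have hη (ζ : K) {t : ℝ} (ht : t < ε) : t * (ψ 1).re * ‖ζ‖ ^ 2 ≤ ε * ((ψ 1).re * ‖ζ‖ ^ 2) := by
      rw [mul_assoc]
      gcongr
    have h4 := (hle η).1.trans (hη η h2)
    have h5 := (hle (D η)).1.trans (hη (D η) h2)
    have h6 := (hle (D η)).2.trans (hη (D η) h1)
    have h7 : w ^ 2 ≤ ε * Q := by
      rw [hQ]
      nlinarith [sq_nonneg (‖f ((T - T') η)‖ - ‖f ((T - T') (D η))‖),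
        sq_nonneg (‖f ((T - T') η)‖ - ‖f ((S - S') (D η))‖),
        sq_nonneg (‖f ((T - T') (D η))‖ - ‖f ((S - S') (D η))‖)]
    have h8 : w ^ 2 = ε * (Q + 1) := by rw [hε]; field_simp
    linarith
  rw [← sub_eq_zero]
  have hz (ξ : H) : inner ℂ ((T η - (T + S) (D η)) ξ) ξ = 0 := by
    have := key (isNormalPLF_inner N ξ)
      (f := (innerSL ℂ ξ) ∘L (ContinuousLinearMap.apply ℂ H ξ)) fun x _ => rfl
    rw [← inner_conj_symm]
    exact (congrArg _ this).trans (_root_.map_zero _)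
  exact ContinuousLinearMap.coe_injective
    ((inner_map_self_eq_zero (T η - (T + S) (D η)).toLinearMap).1 hz)

end IsSliceGNS

end SliceMaps

/-! ### Descent of intertwiners along a slice expectation -/

section Descent

variable {M N P : VonNeumannAlgebra H} {φ ψ : Op H → ℂ} {E : Op H → Op H}

theorem IsSupportProjOf.eq_zero_of_null (h : IsPLF M φ) {p v : Op H} (hp : IsSupportProjOf M φ p)
    (hv : v ∈ M) (hvp : v * p = v) (h0 : φ (star v * v) = 0) : v = 0 := by
  by_contra hne
  obtain ⟨x, hx⟩ : ∃ x, x = star v * v := ⟨_, rfl⟩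
  have hxM : x ∈ M := hx ▸ mul_mem (star_mem hv) hv
  have hx0 : x ≠ 0 := fun hx0 => hne ((CStarRing.star_mul_self_eq_zero_iff v).1 (hx ▸ hx0))
  obtain ⟨e, y, he, he0, hy, -, hyx, hyc⟩ :=
    exists_cut_inverse hxM (hx ▸ star_mul_self_nonneg v) hx0
  have hee : e = y * y * star v * v := by
    rw [← hyx, mul_assoc, ← (hyc x (Commute.refl x)).eq, hx]
    simp only [mul_assoc]
  have hφe : φ e = 0 := by
    have h1 := h.cauchy_schwarz hv (mul_mem (mul_mem hy hy) (star_mem hv))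
    rw [← hee, h0, Complex.zero_re, mul_zero] at h1
    exact norm_eq_zero.1 (pow_eq_zero_iff two_ne_zero |>.1 (le_antisymm h1 (by positivity)))
  have h1 := hp.2.2 _ he.one_sub fun z hz => by
    have e1 : (1 - e) * z * (1 - e) = z - (e * z + z * e - e * (z * e)) := by noncomm_ring
    have hez := mul_mem he.1 hz
    have hze := mul_mem hz he.1
    have heze := mul_mem he.1 hze
    rw [e1, h.map_sub hz (sub_mem (add_mem hez hze) heze), h.map_sub (add_mem hez hze) heze,
      h.map_add _ hez _ hze, (h.mul_eq_zero_of_null he hφe hz).1,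
      (h.mul_eq_zero_of_null he hφe hz).2, (h.mul_eq_zero_of_null he hφe hze).1]
    simp
  have h2 : p * e = 0 := by
    rw [mul_sub, mul_one] at h1
    exact sub_eq_self.1 h1
  have h3 : e * p = e := by rw [hee, mul_assoc, hvp]
  refine he0 ?_
  have h4 := congr(star $h2)
  rwa [star_mul, he.2.1, hp.1.2.1, star_zero, h3] at h4

variable {K : Type} [NormedAddCommGroup K] [InnerProductSpace ℂ K]
  {j : P.toStarSubalgebra →ₗ[ℂ] K} {D : K →L[ℂ] K} {v : Op H} {T S : K →L[ℂ] Op H}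
  {L : Type} [NormedAddCommGroup L] [InnerProductSpace ℂ L]
  {k : N.toStarSubalgebra.toSubalgebra.toSubmodule →L[ℂ] L}

/-- In the right GNS space of a normal functional, left slice maps are compact. -/
theorem IsSliceGNS.isCompactOperator [CompleteSpace L] (h : IsSliceGNS M N P φ E j)
    (hD : ∀ x y : P.toStarSubalgebra, inner ℂ (j x) (D (j y)) = φ (star (x : Op H) * y))
    (hψ : IsNormalPLF N ψ) (hk : ∀ x y, inner ℂ (k x) (k y) = ψ ((y : Op H) * star (x : Op H)))
    (hv : v ∈ M) (hp : IsSlicePair E j v T S)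
    (hT : ∀ η, T η ∈ N.toStarSubalgebra.toSubalgebra.toSubmodule) :
    IsCompactOperator (k ∘L T.codRestrict _ hT) := by
  obtain ⟨A, hA, hAc⟩ := h.exists_isSlicePair_compact hD
  obtain ⟨f, hf⟩ := hψ.toIsPLF.exists_clm
  refine isClosed_setOfPred_isCompactOperator.closure_subset
    (Metric.mem_closure_iff.2 fun ε hε => ?_)
  obtain ⟨a, ha, -, h2⟩ :=
    exists_approx hA (hψ.comp_condExp h.exp.1) hv (show 0 < (ε / 2) ^ 2 by positivity)
  obtain ⟨T', S', hp', -, hc⟩ := hAc a ha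
  have haM : a ∈ M := subset_bicommutant hA ha
  have hT' (η : K) : T' η ∈ N.toStarSubalgebra.toSubalgebra.toSubmodule :=
    (hp'.mem h.dec h.exp.1 h.dense haM η).1
  refine ⟨k ∘L T'.codRestrict _ hT', (hc.codRestrict hT' (vn_isClosed N)).clm_comp k, ?_⟩
  rw [dist_eq_norm]
  refine lt_of_le_of_lt ?_ (half_lt_self hε)
  refine ContinuousLinearMap.opNorm_le_bound _ (half_pos hε).le fun η => ?_
  rw [← pow_le_pow_iff_left₀ (norm_nonneg _) (by positivity) two_ne_zero, mul_pow]
  have h3 := h.re_le hψ.toIsPLF (sub_mem hv haM) (hp.sub h.dec h.exp.1 hv haM hp') hf η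
  have h4 : (k ∘L T.codRestrict _ hT - k ∘L T'.codRestrict _ hT') η =
      k (T.codRestrict _ hT η - T'.codRestrict _ hT' η) := (map_sub k _ _).symm
  have h5 : ‖k (T.codRestrict _ hT η - T'.codRestrict _ hT' η)‖ ^ 2 =
      (ψ ((T - T') η * star ((T - T') η))).re := by
    rw [← inner_self_eq_norm_sq (𝕜 := ℂ), hk]
    rfl
  rw [h4, h5]
  exact h3.trans (by gcongr)

theorem IsSliceGNS.apply_mul (h : IsSliceGNS M N P φ E j) {ψ' : Op H → ℂ} (hψ : IsPLF N ψ)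
    (hψ' : IsPLF N ψ') {l : ℂ} (hrel : ∀ x ∈ M, ψ (E (v * x)) = l * ψ' (E (x * v)))
    (hv : v ∈ M) (hp : IsSlicePair E j v T S) {x : Op H} (hx : x ∈ N) (η : K) :
    ψ (T η * x) = l * ψ' (x * S η) := by
  obtain ⟨f, hf⟩ := hψ.exists_clm
  obtain ⟨g, hg⟩ := hψ'.exists_clm
  have hm := hp.mem h.dec h.exp.1 h.dense hv
  rw [← hf _ (mul_mem (hm η).1 hx), ← hg _ (mul_mem hx (hm η).2)]
  refine h.dense.induction_on (p := fun η => f (T η * x) = l * g (x * S η)) η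
    (isClosed_eq (by fun_prop) (by fun_prop)) fun y => ?_
  have hyM := h.dec.subP y.2
  rw [hf _ (mul_mem (hm _).1 hx), hg _ (mul_mem hx (hm _).2), hp.left, hp.right]
  have h1 := h.exp.1.bimod' 1 (one_mem N) _ (mul_mem hv hyM) x hx
  have h2 := h.exp.1.bimod' x hx _ (mul_mem hyM hv) 1 (one_mem N)
  rw [one_mul, one_mul] at h1
  rw [mul_one, mul_one] at h2
  rw [← h1, ← h2, mul_assoc, hrel _ (mul_mem hyM (h.dec.subN hx)), ← h.dec.comm x hx _ y.2,
    mul_assoc]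

/-- An element killing all products from the right under `ψ ∘ E` is null. -/
theorem IsSliceGNS.null_of_forall (h : IsSliceGNS M N P φ E j) (hψ : IsNormalPLF N ψ)
    (hv : v ∈ M) (hp : IsSlicePair E j v T S) (h0 : ∀ η, ∀ x ∈ N, ψ (T η * x) = 0) :
    ψ (E (v * star v)) = 0 := by
  obtain ⟨A, hA, hind⟩ := exists_product_algebra h.dec
  have hω := hψ.comp_condExp h.exp.1
  have hAM {a : Op H} (ha : a ∈ A) : a ∈ M := subset_bicommutant hA ha
  have h1 : ∀ a ∈ A, ψ (E (v * a)) = 0 := by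
    refine hind _ (fun x hx y hy => ?_) fun a ha b hb ha0 hb0 => ?_
    · have h2 := h.exp.1.bimod' 1 (one_mem N) _ (mul_mem hv (h.dec.subP hy)) x hx
      rw [one_mul, one_mul] at h2
      rw [h.dec.comm x hx y hy, ← mul_assoc, h2]
      have := h0 (j ⟨y, hy⟩) x hx
      rwa [hp.left] at this
    · rw [mul_add]
      have := hω.map_add _ (mul_mem hv ha) _ (mul_mem hv hb)
      rw [this, ha0, hb0, add_zero]
  by_contra hne
  have hw : 0 < ‖ψ (E (v * star v))‖ := norm_pos_iff.2 hne
  have hQ := hω.re_nonneg (star_mem hv)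
  rw [star_star] at hQ
  obtain ⟨Q, hQ'⟩ : ∃ Q, Q = (ψ (E (v * star v))).re := ⟨_, rfl⟩
  rw [← hQ'] at hQ
  obtain ⟨ε, hε⟩ : ∃ ε, ε = ‖ψ (E (v * star v))‖ ^ 2 / (Q + 1) := ⟨_, rfl⟩
  have ε0 : 0 < ε := by rw [hε]; positivity
  obtain ⟨a, ha, h2, -⟩ := exists_approx hA hω (star_mem hv) ε0
  have h3 := hω.toIsPLF.cauchy_schwarz (sub_mem (star_mem hv) (hAM ha)) hv
  have h4 := hω.toIsPLF.map_sub (mul_mem hv (star_mem hv)) (mul_mem hv (hAM ha))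
  simp only [mul_sub v, h4, h1 a ha, sub_zero, ← hQ'] at h3
  have h8 : ‖ψ (E (v * star v))‖ ^ 2 = ε * (Q + 1) := by rw [hε]; field_simp
  nlinarith [mul_le_mul_of_nonneg_left h2.le hQ]

theorem IsSliceGNS.intertwined [CompleteSpace K] (h : IsSliceGNS M N P φ E j)
    (hD : ∀ x y : P.toStarSubalgebra, inner ℂ (j x) (D (j y)) = φ (star (x : Op H) * y))
    (hDs : D.IsSymmetric)
    (hDp : ∀ η, ∃ r : ℝ, 0 ≤ r ∧ r ≤ ‖η‖ ^ 2 ∧ inner ℂ η (D η) = (r : ℂ))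
    {ψ' : Op H → ℂ} (hψ : IsNormalPLF N ψ) (hψ' : IsNormalPLF N ψ') (hv : v ∈ M) {l : ℝ}
    (hl : 0 < l) (hrel : ∀ x ∈ M, ψ (E (v * x)) = (l : ℂ) * ψ' (E (x * v)))
    (hne : ψ (E (v * star v)) ≠ 0) : Intertwined N ψ ψ' := by
  obtain ⟨T, S, hp⟩ := h.exists_isSlicePair hv
  have hTD := h.slice_relation hD hv hp
  have hm := hp.mem h.dec h.exp.1 h.dense hv
  have hmul {x : Op H} (hx : x ∈ N) (η : K) : ψ (T η * x) = l * ψ' (x * S η) :=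
    h.apply_mul hψ.toIsPLF hψ'.toIsPLF hrel hv hp hx η
  obtain ⟨L, _, _, _, k, hk⟩ := exists_right_gns hψ.toIsPLF
  have hτc := h.isCompactOperator hD hψ hk hv hp (fun η => (hm η).1)
  obtain ⟨τ, hτ⟩ : ∃ τ, τ = k ∘L T.codRestrict _ (fun η => (hm η).1) := ⟨_, rfl⟩
  obtain ⟨σ, hσ⟩ : ∃ σ, σ = k ∘L S.codRestrict _ (fun η => (hm η).2) := ⟨_, rfl⟩
  rw [← hτ] at hτc
  have hττ (ζ η : K) : inner ℂ (τ ζ) (τ η) = ψ (T η * star (T ζ)) := by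
    rw [hτ]
    exact hk _ _
  have hστ (ζ η : K) : inner ℂ (σ ζ) (τ η) = l * ψ' (star (S ζ) * S η) := by
    rw [hτ, hσ, ← hmul (star_mem (hm ζ).2)]
    exact hk _ _
  have hτσ (ζ η : K) : inner ℂ (τ ζ) (σ η) = inner ℂ (σ ζ) (τ η) := by
    rw [← inner_conj_symm, hστ, hστ, hψ'.toIsPLF.map_star_mul (hm η).2 (hm ζ).2, map_mul,
      Complex.conj_ofReal]
    rfl
  have hτr (η : K) : τ η = τ (D η) + σ (D η) := by
    rw [hτ, hσ]
    refine (congrArg k (Subtype.ext ?_)).trans (map_add k _ _)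
    exact hTD η
  have hC (ζ η : K) : inner ℂ ζ ((ContinuousLinearMap.adjoint τ ∘L τ) η) =
      inner ℂ (τ ζ) (τ η) := by
    rw [ContinuousLinearMap.comp_apply, ContinuousLinearMap.adjoint_inner_right]
  have hQ (ζ η : K) : inner ℂ (τ ζ) (τ (D η)) = inner ℂ (τ (D ζ)) (τ η) := by
    rw [hτr ζ, hτr η, inner_add_left, inner_add_right, hτσ]
  have hC0 : ContinuousLinearMap.adjoint τ ∘L τ ≠ 0 := fun h0 => by
    refine hne (h.null_of_forall hψ hv hp fun η x hx => ?_)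
    have h1 : τ η = 0 := by
      rw [← inner_self_eq_zero (𝕜 := ℂ), ← hC, h0, zero_apply, inner_zero_right]
    have h2 := hk ⟨star x, star_mem (s := N) hx⟩ (T.codRestrict _ (fun η => (hm η).1) η)
    rw [hτ] at h1
    refine (?_ : _ = inner ℂ (k ⟨star x, star_mem (s := N) hx⟩) (0 : L)).trans (inner_zero_right _)
    rw [← h1]
    refine Eq.trans ?_ h2.symm
    rw [star_star]
    rfl
  obtain ⟨η, c, d, hη, hc, hCη, hDη⟩ := exists_common_eigenvector
    (C := ContinuousLinearMap.adjoint τ ∘L τ) (hτc.clm_comp (ContinuousLinearMap.adjoint τ))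
    (fun ζ η => by
      change inner ℂ (ContinuousLinearMap.adjoint τ (τ ζ)) η = _
      rw [ContinuousLinearMap.adjoint_inner_left]
      exact (hC ζ η).symm) hC0 (D := D) (fun η => ext_inner_left ℂ fun ζ => by
      rw [hC, hQ, ← hC]
      exact hDs _ _)
  have hη2 : 0 < ‖η‖ ^ 2 := by positivity
  have hnn : ψ (T η * star (T η)) ≠ 0 := by
    rw [← hττ, ← hC, hCη, inner_smul_right, inner_self_eq_norm_sq_to_K]
    exact mul_ne_zero hc (pow_ne_zero 2 (RCLike.ofReal_ne_zero.2 (norm_ne_zero_iff.2 hη)))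
  obtain ⟨r, hr0, hr1, hr⟩ := hDp η
  obtain ⟨δ, rfl, hδ0, hδ1⟩ : ∃ δ : ℝ, d = (δ : ℂ) ∧ 0 ≤ δ ∧ δ ≤ 1 := by
    refine ⟨r / ‖η‖ ^ 2, ?_, by positivity, (div_le_one hη2).2 hr1⟩
    rw [hDη, inner_smul_right, inner_self_eq_norm_sq_to_K] at hr
    push_cast
    rw [eq_div_iff (by exact_mod_cast hη2.ne'), ← hr]
    rfl
  have hTS : T η = (δ : ℂ) • (T η + S η) := by
    conv_lhs => rw [hTD, hDη, _root_.map_smul, add_apply]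
  have hδ : 0 < δ := by
    refine hδ0.lt_of_ne fun h0 => hnn ?_
    rw [← h0, Complex.ofReal_zero, zero_smul] at hTS
    rw [hTS, zero_mul, hψ.toIsPLF.map_zero]
  have hδC : (δ : ℂ) ≠ 0 := by exact_mod_cast hδ.ne'
  have hS : S η = (((1 - δ) / δ : ℝ) : ℂ) • T η := by
    have h1 : (δ : ℂ) • S η = (1 - δ : ℂ) • T η := by
      rw [smul_add] at hTS
      rw [sub_smul, one_smul]
      exact eq_sub_of_add_eq' hTS.symm
    rw [Complex.ofReal_div, div_eq_inv_mul, mul_smul, Complex.ofReal_sub, Complex.ofReal_one, ← h1,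
      smul_smul, inv_mul_cancel₀ hδC, one_smul]
  have hlt : δ < 1 := by
    refine hδ1.lt_of_ne fun h1 => hnn ?_
    rw [hmul (star_mem (hm η).1), hS, h1]
    simp [hψ'.toIsPLF.map_zero]
  refine intertwined_of_bounded hψ hψ' (hm η).1 (l := l * ((1 - δ) / δ))
    (mul_pos hl (div_pos (sub_pos.2 hlt) hδ)) hnn fun x hx => ?_
  rw [hmul hx, hS, mul_smul_comm, hψ'.map_smul _ _ (mul_mem hx (hm η).1), Complex.ofReal_mul,
    mul_assoc]

end Descent

/-- Claim in Proposition 4.3.  Let `M = N ⊗̄ P`, `φ_P` a faithful normal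
state on `P` and `E = id_N ⊗ φ_P : M → N` the slice expectation.  For all nonzero
`ψ₁, ψ₂ ∈ (N_*)⁺`: if `ψ₁ ≁_N ψ₂`, then `ψ₁ ∘ E ≁_M ψ₂ ∘ E`. -/
theorem not_intertwined_comp_slice_expectation
    {H : Type} [NormedAddCommGroup H] [InnerProductSpace ℂ H] [CompleteSpace H]
    (M N P : VonNeumannAlgebra H) (hdec : IsTensorDecomposition M N P)
    (φP : Op H → ℂ) (hφP : IsFNState P φP)
    (E : Op H → Op H) (hE : IsSliceExpectation M N P φP E)
    (ψ₁ ψ₂ : Op H → ℂ)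
    (hψ₁ : IsNormalPLF N ψ₁) (hψ₁0 : ∃ x ∈ N, ψ₁ x ≠ 0)
    (hψ₂ : IsNormalPLF N ψ₂) (hψ₂0 : ∃ x ∈ N, ψ₂ x ≠ 0)
    (hnot : ¬ Intertwined N ψ₁ ψ₂) :
    ¬ Intertwined M (fun x => ψ₁ (E x)) (fun x => ψ₂ (E x)) := by
  rintro ⟨v, q, p, l, hl, hv, -, hv0, -, hp, -, hvp, hrel⟩
  have hφ := hφP.1.1.toIsPLF
  obtain ⟨K, _, _, _, j, D, hj, hji, hD, hDs, hDp⟩ := exists_symm_gns hφ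
  refine hnot ((IsSliceGNS.mk hdec hE hφ hj hji).intertwined hD hDs hDp hψ₁ hψ₂ hv hl hrel
    fun h0 => hv0 (hp.eq_zero_of_null (hψ₂.comp_condExp hE.1).toIsPLF hv hvp ?_))
  have h1 := hrel _ (star_mem hv)
  change ψ₁ (E (v * star v)) = _ at h1
  rw [h0] at h1
  exact (mul_eq_zero.1 h1.symm).resolve_left (by exact_mod_cast hl.ne')

end HSC
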